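/- arXiv:1806.00477 — 6 statements merged into one kernel-verified Lean document; each statement's English description precedes it below -/
import Mathlib

section
/- Let 1 < β < 2 and a < b. Let u : [a,b] → ℝ be twice continuously differentiable with u(a) = 0, and let v : [a,b] → ℝ be continuously differentiable with v(b) = 0. Assume that for every x ∈ (a,b) the derivatives defining (D_{a+}^β u)(x), (D_{a+}^{β/2} u)(x) and (D_{b−}^{β/2} v)(x) exist, and that the functions x ↦ (D_{a+}^β u)(x)·v(x) and x ↦ (D_{a+}^{β/2} u)(x)·(D_{b−}^{β/2} v)(x) are integrable on (a,b). Then ∫_a^b (D_{a+}^β u)(x) · v(x) dx = ∫_a^b (D_{a+}^{β/2} u)(x) · (D_{b−}^{β/2} v)(x) dx. -/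
open MeasureTheory Set

/-- Fubini's theorem on a triangle, for a weakly singular kernel. -/
theorem integral_mul_integral_sub_rpow {a b p : ℝ} (hab : a ≤ b) (hp : -1 < p) {φ f : ℝ → ℝ}
    (hφ : IntervalIntegrable φ volume a b) (hf : ContinuousOn f (Icc a b)) :
    ∫ x in a..b, φ x * ∫ s in a..x, (x - s) ^ p * f s
      = ∫ s in a..b, f s * ∫ x in s..b, (x - s) ^ p * φ x := by
  set Φ : ℝ → ℝ := (Ioc a b).indicator φ with hΦ
  set F : ℝ → ℝ := (Ioc a b).indicator f with hF
  set K : ℝ → ℝ := (Ioc 0 (b - a)).indicator (fun t => t ^ p) with hK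
  have hΦi : Integrable Φ := by
    rw [hΦ, integrable_indicator_iff measurableSet_Ioc]
    exact (intervalIntegrable_iff_integrableOn_Ioc_of_le hab).1 hφ
  have hKi : Integrable K := by
    rw [hK, integrable_indicator_iff measurableSet_Ioc]
    exact (intervalIntegrable_iff_integrableOn_Ioc_of_le (sub_nonneg.2 hab)).1
      (intervalIntegral.intervalIntegrable_rpow' hp)
  have hFm : AEStronglyMeasurable F := by
    rw [hF, aestronglyMeasurable_indicator_iff measurableSet_Ioc]
    exact (hf.mono Ioc_subset_Icc_self).aestronglyMeasurable measurableSet_Ioc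
  obtain ⟨M, hM⟩ := isCompact_Icc.exists_bound_of_continuousOn hf
  have hFb : ∀ s, ‖F s‖ ≤ max M 0 := by
    intro s
    by_cases hs : s ∈ Ioc a b
    · simpa [hF, hs] using Or.inl (hM s (Ioc_subset_Icc_self hs))
    · simp [hF, hs]
  have hconv : Integrable (fun z : ℝ × ℝ => Φ z.2 * K (-(z.1 - z.2))) (volume.prod volume) :=
    hΦi.convolution_integrand (ContinuousLinearMap.mul ℝ ℝ) hKi.comp_neg
  have hint : Integrable (Function.uncurry fun s x => F s * (Φ x * K (-(s - x))))
      (volume.prod volume) :=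
    hconv.bdd_mul (c := max M 0) hFm.comp_fst (.of_forall fun z => hFb z.1)
  have hswap := integral_integral_swap hint
  rw [intervalIntegral.integral_of_le hab, intervalIntegral.integral_of_le hab,
    ← integral_indicator measurableSet_Ioc, ← integral_indicator measurableSet_Ioc]
  have hL : ∀ x, (Ioc a b).indicator (fun x => φ x * ∫ s in a..x, (x - s) ^ p * f s) x
      = ∫ s, F s * (Φ x * K (-(s - x))) := by
    intro x
    by_cases hx : x ∈ Ioc a b
    · rw [indicator_of_mem hx, intervalIntegral.integral_of_le hx.1.le, integral_Ioc_eq_integral_Ioo,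
        ← integral_indicator measurableSet_Ioo, ← integral_const_mul]
      congr 1 with s
      by_cases hs : s ∈ Ioo a x
      · have h1 : s ∈ Ioc a b := ⟨hs.1, hs.2.le.trans hx.2⟩
        have h2 : x - s ∈ Ioc 0 (b - a) :=
          ⟨by linarith [hs.2], by linarith [hs.1, hx.2]⟩
        simp only [hF, hΦ, hK, indicator_of_mem hs, indicator_of_mem h1, indicator_of_mem h2,
          indicator_of_mem hx, neg_sub]
        ring
      · rw [indicator_of_notMem hs]
        by_cases h1 : s ∈ Ioc a b
        · have h2 : x - s ∉ Ioc 0 (b - a) := fun h => hs ⟨h1.1, by linarith [h.1]⟩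
          simp only [neg_sub, hK, indicator_of_notMem h2, mul_zero]
        · simp [hF, h1]
    · simp [hΦ, hx]
  have hR : ∀ s, (Ioc a b).indicator (fun s => f s * ∫ x in s..b, (x - s) ^ p * φ x) s
      = ∫ x, F s * (Φ x * K (-(s - x))) := by
    intro s
    by_cases hs : s ∈ Ioc a b
    · rw [indicator_of_mem hs, intervalIntegral.integral_of_le hs.2,
        ← integral_indicator measurableSet_Ioc, ← integral_const_mul]
      congr 1 with x
      by_cases hx : x ∈ Ioc s b
      · have h1 : x ∈ Ioc a b := ⟨hs.1.trans hx.1, hx.2⟩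
        have h2 : x - s ∈ Ioc 0 (b - a) :=
          ⟨by linarith [hx.1], by linarith [hs.1, hx.2]⟩
        simp only [hF, hΦ, hK, indicator_of_mem hs, indicator_of_mem h1, indicator_of_mem h2,
          indicator_of_mem hx, neg_sub]
        ring
      · rw [indicator_of_notMem hx]
        by_cases h1 : x ∈ Ioc a b
        · have h2 : x - s ∉ Ioc 0 (b - a) := fun h => hx ⟨by linarith [h.1], h1.2⟩
          simp only [neg_sub, hK, indicator_of_notMem h2, mul_zero]
        · simp [hΦ, h1]
    · simp [hF, hs]
  simp_rw [hL, hR]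
  exact hswap.symm

/-- A fractional integral of a continuous function is continuous. -/
theorem continuousOn_integral_sub_rpow {a p : ℝ} (hp : -1 < p) {f : ℝ → ℝ} (hf : Continuous f) :
    ContinuousOn (fun y => ∫ s in a..y, (y - s) ^ p * f s) (Ici a) := by
  have hcont : ContinuousOn
      (fun y => (y - a) ^ (p + 1) * ∫ θ in (0 : ℝ)..1, (1 - θ) ^ p * f (a + (y - a) * θ))
      (Ici a) := by
    refine ContinuousOn.mul (Continuous.continuousOn ?_) ?_
    · exact (continuous_id.sub continuous_const).rpow_const fun _ => Or.inr (by linarith)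
    intro y₀ hy₀
    obtain ⟨M, hM⟩ := (isCompact_Icc (a := a) (b := y₀ + 1)).exists_bound_of_continuousOn
      hf.continuousOn
    have hk : IntervalIntegrable (fun θ : ℝ => (1 - θ) ^ p) volume 0 1 := by
      simpa using ((intervalIntegral.intervalIntegrable_rpow' (a := 0) (b := 1) hp).comp_sub_left
        1).symm
    refine intervalIntegral.continuousWithinAt_of_dominated_interval
      (bound := fun θ => (1 - θ) ^ p * M) ?_ ?_ (hk.mul_const M) ?_
    · refine .of_forall fun y => ?_
      have : Measurable fun θ : ℝ => (1 - θ) ^ p * f (a + (y - a) * θ) := by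
        have := hf.measurable
        fun_prop
      exact this.aestronglyMeasurable
    · have : Iio (y₀ + 1) ∈ nhdsWithin y₀ (Ici a) :=
        mem_nhdsWithin_of_mem_nhds (Iio_mem_nhds (by linarith))
      filter_upwards [this, self_mem_nhdsWithin] with y hy hya
      refine .of_forall fun θ hθ => ?_
      rw [uIoc_of_le zero_le_one] at hθ
      simp only [mem_Iio, mem_Ici] at hy hya
      have h1 : 0 ≤ (1 - θ) ^ p := Real.rpow_nonneg (by linarith [hθ.2]) _
      rw [norm_mul, Real.norm_of_nonneg h1]
      refine mul_le_mul_of_nonneg_left (hM _ ⟨?_, ?_⟩) h1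
      · nlinarith [hθ.1]
      · nlinarith [hθ.2, hθ.1]
    · refine .of_forall fun θ _ => Continuous.continuousWithinAt ?_
      fun_prop
  refine hcont.congr fun y hy => ?_
  have hy' : 0 ≤ y - a := sub_nonneg.2 hy
  have h := intervalIntegral.smul_integral_comp_add_mul (a := 0) (b := 1)
    (fun s => (y - s) ^ p * f s) (y - a) a
  simp only [mul_zero, add_zero, mul_one, add_sub_cancel, smul_eq_mul] at h
  dsimp only
  rw [← h, Real.rpow_add_one' hy' (by linarith), mul_comm (_ ^ p), mul_assoc,
    ← intervalIntegral.integral_const_mul ((y - a) ^ p)]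
  congr 1
  refine intervalIntegral.integral_congr fun θ hθ => ?_
  rw [uIcc_of_le zero_le_one] at hθ
  rw [← mul_assoc, ← Real.mul_rpow hy' (by linarith [hθ.2])]
  congr 2
  ring

theorem intervalIntegrable_sub_rpow {a b c p : ℝ} (hp : -1 < p) :
    IntervalIntegrable (fun x => (c - x) ^ p) volume a b := by
  simpa using (intervalIntegral.intervalIntegrable_rpow' (a := c - a) (b := c - b) hp).comp_sub_left
    c

/-- Differentiating a left-sided fractional integral of an antiderivative. -/
theorem hasDerivAt_integral_sub_rpow {a b p : ℝ} (hp : -1 < p) {u f : ℝ → ℝ} (hf : Continuous f)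
    (hu : ∀ y ∈ Icc a b, u y = ∫ s in a..y, f s) {x : ℝ} (hx : x ∈ Ioo a b) :
    HasDerivAt (fun y => ∫ s in a..y, (y - s) ^ p * u s) (∫ s in a..x, (x - s) ^ p * f s) x := by
  have hG := continuousOn_integral_sub_rpow (a := a) hp hf
  set G : ℝ → ℝ := fun y => ∫ s in a..y, (y - s) ^ p * f s with hGdef
  have hprim : ∀ y ∈ Ioo a b, ∫ s in a..y, (y - s) ^ p * u s = ∫ z in a..y, G z := by
    intro y hy
    have h1 := integral_mul_integral_sub_rpow hy.1.le hp (φ := fun _ => 1)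
      intervalIntegrable_const (hf.continuousOn (s := Icc a y))
    have h2 := integral_mul_integral_sub_rpow hy.1.le (p := 0) (by norm_num)
      (intervalIntegrable_sub_rpow (a := a) (b := y) (c := y) hp) (hf.continuousOn (s := Icc a y))
    simp only [one_mul, Real.rpow_zero, mul_one] at h1 h2
    rw [h1]
    calc ∫ s in a..y, (y - s) ^ p * u s
        = ∫ s in a..y, (y - s) ^ p * ∫ t in a..s, f t := by
          refine intervalIntegral.integral_congr fun s hs => ?_
          rw [uIcc_of_le hy.1.le] at hs
          rw [hu s ⟨hs.1, hs.2.trans hy.2.le⟩]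
      _ = _ := by
          rw [h2]
          refine intervalIntegral.integral_congr fun s _ => congrArg (f s * ·) ?_
          rw [intervalIntegral.integral_comp_sub_left (fun t => t ^ p),
            intervalIntegral.integral_comp_sub_right (fun t => t ^ p), sub_self, sub_self]
  have hGx : ContinuousAt G x := hG.continuousAt (Ici_mem_nhds hx.1)
  have hGi : IntervalIntegrable G volume a x :=
    (hG.mono (by rw [uIcc_of_le hx.1.le]; exact Icc_subset_Ici_self)).intervalIntegrable
  have hGm : StronglyMeasurableAtFilter G (nhds x) :=
    (hG.mono Ioi_subset_Ici_self).stronglyMeasurableAtFilter isOpen_Ioi x hx.1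
  refine (intervalIntegral.integral_hasDerivAt_right hGi hGm hGx).congr_of_eventuallyEq ?_
  filter_upwards [Ioo_mem_nhds hx.1 hx.2] with y hy using hprim y hy

/-- Differentiating a right-sided fractional integral of an antiderivative. -/
theorem hasDerivAt_integral_sub_rpow_right {a b p : ℝ} (hp : -1 < p) {v h : ℝ → ℝ}
    (hh : Continuous h) (hv : ∀ y ∈ Icc a b, v y = -∫ s in y..b, h s) {x : ℝ} (hx : x ∈ Ioo a b) :
    HasDerivAt (fun y => ∫ s in y..b, (s - y) ^ p * v s) (∫ s in x..b, (s - x) ^ p * h s) x := by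
  have key := hasDerivAt_integral_sub_rpow (a := -b) (b := -a) (x := -x) hp
    (u := fun t => v (-t)) (f := fun t => -h (-t)) (by fun_prop)
    (fun y hy => by
      rw [hv (-y) ⟨by linarith [hy.2], by linarith [hy.1]⟩, intervalIntegral.integral_neg,
        intervalIntegral.integral_comp_neg (fun t => h t), neg_neg])
    ⟨by linarith [hx.2], by linarith [hx.1]⟩
  have hrefl : ∀ (w : ℝ → ℝ) (y : ℝ),
      ∫ s in -b..-y, (-y - s) ^ p * w (-s) = ∫ s in y..b, (s - y) ^ p * w s := by
    intro w y
    have := intervalIntegral.integral_comp_neg (a := -b) (b := -y) (fun s => (s - y) ^ p * w s)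
    rw [neg_neg, neg_neg] at this
    rw [← this]
    refine intervalIntegral.integral_congr fun s _ => ?_
    congr 2
    ring
  have hcomp : HasDerivAt (fun y => ∫ s in -b..-y, (-y - s) ^ p * v (-s))
      (-1 * ∫ s in -b..-x, (-x - s) ^ p * -h (-s)) x := key.scomp x (hasDerivAt_neg x)
  simp_rw [hrefl v] at hcomp
  refine hcomp.congr_deriv ?_
  rw [hrefl (fun t => -h t) x]
  simp

theorem integral_sub_rpow_mul_sub_rpow {s r p : ℝ} (hp : -1 < p) (hsr : s < r) :
    ∫ x in s..r, (x - s) ^ p * (r - x) ^ p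
      = Real.Gamma (1 + p) * Real.Gamma (1 + p) / Real.Gamma (2 + 2 * p)
        * (r - s) ^ (2 * p + 1) := by
  have hL : 0 < r - s := sub_pos.2 hsr
  have hshift := intervalIntegral.integral_comp_sub_right (a := s) (b := r)
    (fun t => t ^ p * (r - s - t) ^ p) s
  simp only [sub_self, sub_sub_sub_cancel_right] at hshift
  have hC := Complex.betaIntegral_scaled ((1 + p : ℝ) : ℂ) ((1 + p : ℝ) : ℂ) hL
  have hcast : ∫ t in (0 : ℝ)..(r - s), (t : ℂ) ^ (((1 + p : ℝ) : ℂ) - 1)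
        * (((r - s : ℝ) : ℂ) - t) ^ (((1 + p : ℝ) : ℂ) - 1)
      = ((∫ t in (0 : ℝ)..(r - s), t ^ p * (r - s - t) ^ p : ℝ) : ℂ) := by
    rw [← intervalIntegral.integral_ofReal]
    refine intervalIntegral.integral_congr fun t ht => ?_
    rw [uIcc_of_le hL.le] at ht
    have h1 : ((1 + p : ℝ) : ℂ) - 1 = (p : ℂ) := by push_cast; ring
    simp only [h1]
    rw [Complex.ofReal_mul, Complex.ofReal_cpow ht.1, Complex.ofReal_cpow (sub_nonneg.2 ht.2),
      Complex.ofReal_sub (r - s) t]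
  have hB : Complex.betaIntegral ((1 + p : ℝ) : ℂ) ((1 + p : ℝ) : ℂ)
      = ((Real.Gamma (1 + p) * Real.Gamma (1 + p) / Real.Gamma (2 + 2 * p) : ℝ) : ℂ) := by
    have h0 : 0 < (((1 + p : ℝ) : ℂ)).re := by simp only [Complex.ofReal_re]; linarith
    rw [Complex.betaIntegral_eq_Gamma_mul_div _ _ h0 h0, ← Complex.ofReal_add,
      show 1 + p + (1 + p) = 2 + 2 * p by ring]
    simp only [Complex.Gamma_ofReal]
    push_cast
    rfl
  have hE : ((r - s : ℝ) : ℂ) ^ (((1 + p : ℝ) : ℂ) + ((1 + p : ℝ) : ℂ) - 1)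
      = (((r - s) ^ (2 * p + 1) : ℝ) : ℂ) := by
    rw [Complex.ofReal_cpow hL.le]
    congr 1
    push_cast
    ring
  rw [hcast, hB, hE] at hC
  rw [mul_comm] at hC
  rw [hshift]
  exact_mod_cast hC

/-- Composing two fractional integrals of the same order. -/
theorem integral_sub_rpow_mul_integral_sub_rpow {a r p : ℝ} (har : a ≤ r) (hp : -1 < p)
    {f : ℝ → ℝ} (hf : Continuous f) :
    ∫ x in a..r, (r - x) ^ p * ∫ s in a..x, (x - s) ^ p * f s
      = Real.Gamma (1 + p) * Real.Gamma (1 + p) / Real.Gamma (2 + 2 * p)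
        * ∫ s in a..r, (r - s) ^ (2 * p + 1) * f s := by
  rw [integral_mul_integral_sub_rpow har hp (intervalIntegrable_sub_rpow hp) hf.continuousOn,
    ← intervalIntegral.integral_const_mul, intervalIntegral.integral_of_le har,
    intervalIntegral.integral_of_le har, integral_Ioc_eq_integral_Ioo,
    integral_Ioc_eq_integral_Ioo]
  refine setIntegral_congr_fun measurableSet_Ioo fun s hs => ?_
  rw [integral_sub_rpow_mul_sub_rpow hp hs.2]
  ring

/-- A fractional integral of twice the order, moved half onto the other factor. -/
theorem integral_integral_sub_rpow_mul_integral_sub_rpow {a b p : ℝ} (hab : a ≤ b) (hp : -1 < p)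
    {f h : ℝ → ℝ} (hf : Continuous f) (hh : Continuous h) :
    ∫ x in a..b, (∫ s in a..x, (x - s) ^ p * f s) * ∫ r in x..b, (r - x) ^ p * h r
      = Real.Gamma (1 + p) * Real.Gamma (1 + p) / Real.Gamma (2 + 2 * p)
        * ∫ r in a..b, (∫ s in a..r, (r - s) ^ (2 * p + 1) * f s) * h r := by
  rw [← integral_mul_integral_sub_rpow hab hp (hh.intervalIntegrable a b)
    ((continuousOn_integral_sub_rpow hp hf).mono Icc_subset_Ici_self),
    ← intervalIntegral.integral_const_mul]
  refine intervalIntegral.integral_congr fun r hr => ?_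
  rw [uIcc_of_le hab] at hr
  rw [integral_sub_rpow_mul_integral_sub_rpow hr.1 hp hf]
  ring

theorem ContDiffOn.exists_continuous_hasDerivAt {a b : ℝ} (hab : a < b) {w : ℝ → ℝ}
    (hw : ContDiffOn ℝ 1 w (Icc a b)) :
    ∃ f : ℝ → ℝ, Continuous f ∧ ∀ x ∈ Ioo a b, HasDerivAt w (f x) x := by
  refine ⟨IccExtend hab.le ((Icc a b).domRestrict (derivWithin w (Icc a b))), ?_, fun x hx => ?_⟩
  · exact (hw.continuousOn_derivWithin (uniqueDiffOn_Icc hab) le_rfl).domRestrict.Icc_extend'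
  · have hx' := Ioo_subset_Icc_self hx
    rw [IccExtend_of_mem _ _ hx']
    exact ((hw.differentiableOn one_ne_zero x hx').hasDerivWithinAt).hasDerivAt
      (Icc_mem_nhds hx.1 hx.2)

/-- Lemma 2.5 of the paper.
Splitting of a fractional derivative of order `β ∈ (1,2)` into two half-order
derivatives via integration by parts: `u` twice continuously differentiable on `[a,b]`
with `u(a) = 0`, `v` continuously differentiable with `v(b) = 0`; `g1` is the first
derivative and `g1'` the second derivative of `y ↦ ∫_a^y (y-s)^{1-β} u(s) ds`, so that
`D_{a+}^β u = (1/Γ(2-β)) g1'`; `g2`, `g3` define the half-order derivatives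
`D_{a+}^{β/2} u = (1/Γ(1-β/2)) g2` and `D_{b-}^{β/2} v = (-1/Γ(1-β/2)) g3`.
Then `∫_a^b (D_{a+}^β u) v = ∫_a^b (D_{a+}^{β/2} u)(D_{b-}^{β/2} v)`. -/
theorem stmt9 (β a b : ℝ) (hβ1 : 1 < β) (hβ2 : β < 2) (hab : a < b)
    (u v : ℝ → ℝ)
    (hu : ContDiffOn ℝ 2 u (Set.Icc a b)) (hua : u a = 0)
    (hv : ContDiffOn ℝ 1 v (Set.Icc a b)) (hvb : v b = 0)
    (g1 g1' g2 g3 : ℝ → ℝ)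
    (hg1 : ∀ x ∈ Set.Ioo a b,
      HasDerivAt (fun y => ∫ s in a..y, (y - s) ^ (1 - β) * u s) (g1 x) x)
    (hg1' : ∀ x ∈ Set.Ioo a b, HasDerivAt g1 (g1' x) x)
    (hg2 : ∀ x ∈ Set.Ioo a b,
      HasDerivAt (fun y => ∫ s in a..y, (y - s) ^ (-(β/2)) * u s) (g2 x) x)
    (hg3 : ∀ x ∈ Set.Ioo a b,
      HasDerivAt (fun y => ∫ s in y..b, (s - y) ^ (-(β/2)) * v s) (g3 x) x)
    (hint1 : IntervalIntegrable (fun x => (1 / Real.Gamma (2 - β)) * g1' x * v x)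
      MeasureTheory.volume a b)
    (hint2 : IntervalIntegrable (fun x =>
        ((1 / Real.Gamma (1 - β/2)) * g2 x) * ((-1 / Real.Gamma (1 - β/2)) * g3 x))
      MeasureTheory.volume a b) :
    ∫ x in a..b, (1 / Real.Gamma (2 - β)) * g1' x * v x
      = ∫ x in a..b,
          ((1 / Real.Gamma (1 - β/2)) * g2 x) * ((-1 / Real.Gamma (1 - β/2)) * g3 x) := by
  have hu1 : ContDiffOn ℝ 1 u (Icc a b) := hu.of_le (by norm_num)
  obtain ⟨f, hf, huf⟩ := hu1.exists_continuous_hasDerivAt hab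
  obtain ⟨h, hh, hvh⟩ := hv.exists_continuous_hasDerivAt hab
  have hp : -1 < -(β / 2) := by linarith
  have hq : -1 < 1 - β := by linarith
  have hq' : 2 * (-(β / 2)) + 1 = 1 - β := by ring
  have hu_int : ∀ y ∈ Icc a b, u y = ∫ s in a..y, f s := fun y hy => by
    rw [intervalIntegral.integral_eq_sub_of_hasDerivAt_of_le hy.1
      (hu.continuousOn.mono (Icc_subset_Icc_right hy.2))
      (fun x hx => huf x ⟨hx.1, hx.2.trans_le hy.2⟩) (hf.intervalIntegrable a y), hua, sub_zero]
  have hv_int : ∀ y ∈ Icc a b, v y = -∫ s in y..b, h s := fun y hy => by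
    rw [intervalIntegral.integral_eq_sub_of_hasDerivAt_of_le hy.2
      (hv.continuousOn.mono (Icc_subset_Icc_left hy.1))
      (fun x hx => hvh x ⟨hy.1.trans_lt hx.1, hx.2⟩) (hh.intervalIntegrable y b), hvb]
    ring
  set G : ℝ → ℝ := fun y => ∫ s in a..y, (y - s) ^ (1 - β) * f s with hGdef
  have hG : ContinuousOn G (Icc a b) :=
    (continuousOn_integral_sub_rpow hq hf).mono Icc_subset_Ici_self
  have hg1G : ∀ x ∈ Ioo a b, g1 x = G x := fun x hx =>
    (hg1 x hx).unique (hasDerivAt_integral_sub_rpow hq hf hu_int hx)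
  have hGderiv : ∀ x ∈ Ioo a b, HasDerivAt G (g1' x) x := fun x hx =>
    (hg1' x hx).congr_of_eventuallyEq <| by
      filter_upwards [Ioo_mem_nhds hx.1 hx.2] with y hy using (hg1G y hy).symm
  have hΓ2 : 0 < Real.Gamma (2 - β) := Real.Gamma_pos_of_pos (by linarith)
  have hΓ1 : 0 < Real.Gamma (1 - β / 2) := Real.Gamma_pos_of_pos (by linarith)
  have hGh : IntervalIntegrable (fun x => 1 / Real.Gamma (2 - β) * (G x * h x)) volume a b :=
    ContinuousOn.intervalIntegrable_of_Icc hab.le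
      (continuousOn_const.mul (hG.mul hh.continuousOn))
  have hparts := intervalIntegral.integral_eq_sub_of_hasDerivAt_of_le hab.le
    (f := fun x => 1 / Real.Gamma (2 - β) * (G x * v x))
    (f' := fun x => 1 / Real.Gamma (2 - β) * g1' x * v x + 1 / Real.Gamma (2 - β) * (G x * h x))
    (continuousOn_const.mul (hG.mul hv.continuousOn))
    (fun x hx => by
      refine (((hGderiv x hx).mul (hvh x hx)).const_mul (1 / Real.Gamma (2 - β))).congr_deriv ?_
      ring)
    (hint1.add hGh)
  have hGa : G a = 0 := by simp [hGdef]
  rw [intervalIntegral.integral_add hint1 hGh, hvb, hGa, intervalIntegral.integral_const_mul]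
    at hparts
  have hright : ∫ x in a..b,
        ((1 / Real.Gamma (1 - β / 2)) * g2 x) * ((-1 / Real.Gamma (1 - β / 2)) * g3 x)
      = -(1 / (Real.Gamma (1 - β / 2) * Real.Gamma (1 - β / 2)))
        * ∫ x in a..b, (∫ s in a..x, (x - s) ^ (-(β / 2)) * f s)
          * ∫ r in x..b, (r - x) ^ (-(β / 2)) * h r := by
    rw [← intervalIntegral.integral_const_mul, intervalIntegral.integral_of_le hab.le,
      intervalIntegral.integral_of_le hab.le, integral_Ioc_eq_integral_Ioo,
      integral_Ioc_eq_integral_Ioo]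
    refine setIntegral_congr_fun measurableSet_Ioo fun x hx => ?_
    rw [(hg2 x hx).unique (hasDerivAt_integral_sub_rpow hp hf hu_int hx),
      (hg3 x hx).unique (hasDerivAt_integral_sub_rpow_right hp hh hv_int hx)]
    field_simp
  rw [hright, integral_integral_sub_rpow_mul_integral_sub_rpow hab.le hp hf hh, hq',
    show 1 + -(β / 2) = 1 - β / 2 by ring, show 2 + 2 * (-(β / 2)) = 2 - β by ring]
  rw [eq_sub_of_add_eq hparts]
  generalize Real.Gamma (1 - β / 2) = c at hΓ1 ⊢
  field_simp
  ring
end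

section
/- Let d ≥ 1, let Λ = ∏_{i=1}^d (a_i, b_i) be a bounded open box in ℝ^d, fix j ∈ {1,…,d}, and let 1 < β_j < 2. Let u, v : cl(Λ) → ℝ be such that for every fixed value of the coordinates other than x_j: (i) x_j ↦ u is twice continuously differentiable on [a_j, b_j] with u = 0 at x_j = a_j; (ii) x_j ↦ v is continuously differentiable on [a_j, b_j] with v = 0 at x_j = b_j; (iii) the pointwise one-dimensional fractional derivatives in the x_j variable, D_{a_j+}^{β_j} u, D_{a_j+}^{β_j/2} u and D_{b_j−}^{β_j/2} v (with the other coordinates frozen), exist on (a_j, b_j); and (iv) the functions (D_{a_j+}^{β_j} u)·v and (D_{a_j+}^{β_j/2} u)·(D_{b_j−}^{β_j/2} v) are integrable on Λ. Then ∫_Λ (D_{a_j+}^{β_j} u) · v dΛ = ∫_Λ (D_{a_j+}^{β_j/2} u) · (D_{b_j−}^{β_j/2} v) dΛ. Symmetrically, if instead u = 0 at x_j = b_j and v = 0 at x_j = a_j (with the mirrored regularity and integrability assumptions), then ∫_Λ (D_{b_j−}^{β_j} u) · v dΛ = ∫_Λ (D_{b_j−}^{β_j/2} u) · (D_{a_j+}^{β_j/2}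 v) dΛ. -/
open MeasureTheory Set Filter Topology

/-- The one-sided power kernel `x ↦ x ^ e` on `(0, ∞)`, extended by zero. -/
noncomputable def powKernel (e x : ℝ) : ℝ := if 0 < x then x ^ e else 0

lemma measurable_powKernel (e : ℝ) : Measurable (powKernel e) :=
  Measurable.ite measurableSet_Ioi (by fun_prop) measurable_const

lemma powKernel_nonneg (e x : ℝ) : 0 ≤ powKernel e x := by
  unfold powKernel
  split_ifs with h
  · positivity
  · exact le_rfl

lemma powKernel_of_pos {e x : ℝ} (h : 0 < x) : powKernel e x = x ^ e := if_pos h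

lemma powKernel_of_nonpos {e x : ℝ} (h : x ≤ 0) : powKernel e x = 0 := if_neg h.not_gt

lemma integral_rpow_mul_sub_rpow {e L : ℝ} (he : -1 < e) (hL : 0 < L) :
    ∫ x in (0 : ℝ)..L, x ^ e * (L - x) ^ e =
      L ^ (2 * e + 1) * (Real.Gamma (e + 1) ^ 2 / Real.Gamma (2 * e + 2)) := by
  have h := Complex.betaIntegral_scaled ((e + 1 : ℝ) : ℂ) ((e + 1 : ℝ) : ℂ) hL
  have h2 := Complex.betaIntegral_eq_Gamma_mul_div ((e + 1 : ℝ) : ℂ) ((e + 1 : ℝ) : ℂ)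
    (by rw [Complex.ofReal_re]; linarith) (by rw [Complex.ofReal_re]; linarith)
  have h3 : ∫ x in (0 : ℝ)..L, (x : ℂ) ^ (((e + 1 : ℝ) : ℂ) - 1) *
      ((L : ℂ) - x) ^ (((e + 1 : ℝ) : ℂ) - 1)
      = ((∫ x in (0 : ℝ)..L, x ^ e * (L - x) ^ e : ℝ) : ℂ) := by
    rw [← intervalIntegral.integral_ofReal]
    refine intervalIntegral.integral_congr fun x hx => ?_
    rw [uIcc_of_le hL.le] at hx
    have e1 : ((e + 1 : ℝ) : ℂ) - 1 = (e : ℂ) := by push_cast; ring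
    simp only [e1]
    rw [← Complex.ofReal_sub, ← Complex.ofReal_cpow hx.1, ← Complex.ofReal_cpow (by linarith [hx.2])]
    push_cast; ring
  rw [h3, h2] at h
  have e2 : ((e + 1 : ℝ) : ℂ) + ((e + 1 : ℝ) : ℂ) - 1 = ((2 * e + 1 : ℝ) : ℂ) := by
    push_cast; ring
  have e3 : ((e + 1 : ℝ) : ℂ) + ((e + 1 : ℝ) : ℂ) = ((2 * e + 2 : ℝ) : ℂ) := by
    push_cast; ring
  rw [e2, e3, Complex.Gamma_ofReal, Complex.Gamma_ofReal, ← Complex.ofReal_cpow hL.le] at h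
  rw [sq]
  exact_mod_cast h

lemma powKernel_mul_powKernel_eq_zero {e s t : ℝ} (h : t ≤ s) (z : ℝ) :
    powKernel e (z - s) * powKernel e (t - z) = 0 := by
  rcases le_or_gt z s with h1 | h1
  · rw [powKernel_of_nonpos (by linarith), zero_mul]
  · rw [powKernel_of_nonpos (x := t - z) (by linarith), mul_zero]

lemma integral_powKernel_mul_powKernel {e : ℝ} (he : -1 < e) (s t : ℝ) :
    ∫ z, powKernel e (z - s) * powKernel e (t - z) =
      Real.Gamma (e + 1) ^ 2 / Real.Gamma (2 * e + 2) * powKernel (2 * e + 1) (t - s) := by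
  rcases le_or_gt t s with h | h
  · simp [powKernel_mul_powKernel_eq_zero h, powKernel_of_nonpos (sub_nonpos.2 h)]
  · have hL : 0 < t - s := sub_pos.2 h
    rw [powKernel_of_pos hL, mul_comm, ← integral_rpow_mul_sub_rpow he hL,
      ← integral_add_right_eq_self _ s, intervalIntegral.integral_of_le hL.le,
      integral_Ioc_eq_integral_Ioo, ← integral_indicator measurableSet_Ioo]
    refine integral_congr_ae (Eventually.of_forall fun x => ?_)
    simp only [indicator, mem_Ioo, add_sub_cancel_right]
    split_ifs with hx
    · rw [powKernel_of_pos hx.1, powKernel_of_pos (by linarith [hx.2])]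
      congr 2; ring
    · rcases le_or_gt x 0 with h1 | h1
      · rw [powKernel_of_nonpos h1, zero_mul]
      · rw [powKernel_of_nonpos (x := t - (x + s)), mul_zero]
        by_contra h2
        exact hx ⟨h1, by linarith⟩

lemma integrable_powKernel_mul_powKernel {e : ℝ} (he : -1 < e) (s t : ℝ) :
    Integrable fun z => powKernel e (z - s) * powKernel e (t - z) := by
  rcases le_or_gt t s with h | h
  · simp [powKernel_mul_powKernel_eq_zero h]
  · by_contra hn
    have h1 := integral_powKernel_mul_powKernel he s t
    rw [integral_undef hn, powKernel_of_pos (sub_pos.2 h)] at h1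
    have g1 := Real.Gamma_pos_of_pos (show 0 < e + 1 by linarith)
    have g2 := Real.Gamma_pos_of_pos (show 0 < 2 * e + 2 by linarith)
    have := Real.rpow_pos_of_pos (sub_pos.2 h) (2 * e + 1)
    have : 0 < Real.Gamma (e + 1) ^ 2 / Real.Gamma (2 * e + 2) * (t - s) ^ (2 * e + 1) := by
      positivity
    linarith

lemma integrable_of_measurable_of_support {P : ℝ → ℝ} {a b M : ℝ} (hP : Measurable P)
    (hM : ∀ x, |P x| ≤ M) (h0 : ∀ x ∉ Ioo a b, P x = 0) : Integrable P := by
  have : IntegrableOn P (Ioo a b) :=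
    Measure.integrableOn_of_bounded (M := M) (by simp) hP.aestronglyMeasurable
      (Eventually.of_forall fun x => hM x)
  exact (integrableOn_iff_integrable_of_support_subset
    (fun x hx => by by_contra h; exact hx (h0 x h))).1 this

lemma integrable_powKernel_sub_mul_mul {c : ℝ} (hc : -1 < c) {P Q : ℝ → ℝ} {a b M N : ℝ}
    (hP : Measurable P) (hPM : ∀ x, |P x| ≤ M) (hP0 : ∀ x ∉ Ioo a b, P x = 0)
    (hQ : Measurable Q) (hQN : ∀ x, |Q x| ≤ N) (hQ0 : ∀ x ∉ Ioo a b, Q x = 0) :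
    Integrable (fun p : ℝ × ℝ => powKernel c (p.2 - p.1) * (P p.1 * Q p.2))
      (volume.prod volume) := by
  have hk : Integrable ((Ioc 0 (b - a)).indicator (powKernel c)) := by
    rw [integrable_indicator_iff measurableSet_Ioc]
    rcases le_or_gt (b - a) 0 with h | h
    · simp [Ioc_eq_empty_of_le h]
    refine IntegrableOn.congr_fun (f := fun x => x ^ c) ?_
      (fun x hx => (powKernel_of_pos hx.1).symm) measurableSet_Ioc
    exact (intervalIntegrable_iff_integrableOn_Ioc_of_le h.le).1
      (intervalIntegral.intervalIntegrable_rpow' hc)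
  have h1 := (integrable_of_measurable_of_support hP hPM hP0).convolution_integrand
    (ContinuousLinearMap.mul ℝ ℝ) hk
  have h2 := h1.swap.bdd_mul (f := fun p : ℝ × ℝ => Q p.2) (c := N)
    (hQ.comp measurable_snd).aestronglyMeasurable (Eventually.of_forall fun p => hQN p.2)
  refine h2.congr (Eventually.of_forall fun p => ?_)
  simp only [Function.comp, Prod.swap, ContinuousLinearMap.mul_apply']
  by_cases h3 : p.1 ∈ Ioo a b
  · by_cases h4 : p.2 ∈ Ioo a b
    · rcases le_or_gt (p.2 - p.1) 0 with h5 | h5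
      · rw [indicator_of_notMem (fun h => h.1.not_ge h5), powKernel_of_nonpos h5]; ring
      · rw [indicator_of_mem (mem_Ioc.2 ⟨h5, by linarith [h3.1, h4.2]⟩)]; ring
    · rw [hQ0 _ h4]; ring
  · rw [hP0 _ h3]; ring

lemma integral_powKernel_convolution_mul {e : ℝ} (he : -1 < e) {P Q : ℝ → ℝ} {a b M N : ℝ}
    (hP : Measurable P) (hPM : ∀ x, |P x| ≤ M) (hP0 : ∀ x ∉ Ioo a b, P x = 0)
    (hQ : Measurable Q) (hQN : ∀ x, |Q x| ≤ N) (hQ0 : ∀ x ∉ Ioo a b, Q x = 0) :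
    ∫ z, (∫ s, powKernel e (z - s) * P s) * (∫ t, powKernel e (t - z) * Q t) =
      Real.Gamma (e + 1) ^ 2 / Real.Gamma (2 * e + 2) *
        ∫ t, (∫ s, powKernel (2 * e + 1) (t - s) * P s) * Q t := by
  set B := Real.Gamma (e + 1) ^ 2 / Real.Gamma (2 * e + 2)
  have hB : 0 ≤ B := by
    have g2 := Real.Gamma_pos_of_pos (show 0 < 2 * e + 2 by linarith)
    positivity
  let f : ℝ → ℝ × ℝ → ℝ := fun z p =>
    (powKernel e (z - p.1) * P p.1) * (powKernel e (p.2 - z) * Q p.2)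
  have hfeq : ∀ z p, f z p = (powKernel e (z - p.1) * powKernel e (p.2 - z)) * (P p.1 * Q p.2) :=
    fun z p => by simp only [f]; ring
  have hk := measurable_powKernel e
  have hfm : Measurable (Function.uncurry f) := by
    simp only [Function.uncurry_def, f]
    fun_prop
  have hc := integrable_powKernel_sub_mul_mul (c := 2 * e + 1) (by linarith) hP hPM hP0 hQ hQN hQ0
  have hfi : Integrable (Function.uncurry f) (volume.prod (volume.prod volume)) := by
    rw [integrable_prod_iff' hfm.aestronglyMeasurable]
    simp only [Function.uncurry_apply_pair, hfeq]
    refine ⟨Eventually.of_forall fun p =>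
      (integrable_powKernel_mul_powKernel he p.1 p.2).mul_const _, ?_⟩
    refine (hc.norm.const_mul B).congr (Eventually.of_forall fun p => ?_)
    simp only [norm_mul, Real.norm_of_nonneg (powKernel_nonneg _ _)]
    rw [integral_mul_const, integral_powKernel_mul_powKernel he]
    ring
  calc _ = ∫ z, ∫ p, f z p ∂(volume.prod volume) := by
        congr 1; ext z
        exact (integral_prod_mul (fun s => powKernel e (z - s) * P s)
          (fun t => powKernel e (t - z) * Q t)).symm
    _ = ∫ p, (∫ z, f z p) ∂(volume.prod volume) := integral_integral_swap hfi
    _ = ∫ p : ℝ × ℝ, B * (powKernel (2 * e + 1) (p.2 - p.1) * (P p.1 * Q p.2))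
          ∂(volume.prod volume) := by
        congr 1; ext p
        simp only [hfeq]
        rw [integral_mul_const, integral_powKernel_mul_powKernel he]
        ring
    _ = _ := by
        rw [integral_const_mul, integral_prod_symm _ hc]
        congr 2; ext t
        rw [← integral_mul_const]
        congr 1; ext s; simp only; ring

lemma integral_powKernel_mul_eq_intervalIntegral {e a z L : ℝ} (hL : 0 ≤ L) (hz : z ≤ a + L)
    {P : ℝ → ℝ} (hP0 : ∀ x ≤ a, P x = 0) :
    ∫ s, powKernel e (z - s) * P s = ∫ r in (0 : ℝ)..L, r ^ e * P (z - r) := by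
  rw [← integral_sub_left_eq_self _ volume z, intervalIntegral.integral_of_le hL,
    ← integral_indicator measurableSet_Ioc]
  refine integral_congr_ae (Eventually.of_forall fun r => ?_)
  simp only [sub_sub_cancel, indicator, mem_Ioc]
  split_ifs with h
  · rw [powKernel_of_pos h.1]
  · rcases le_or_gt r 0 with h1 | h1
    · rw [powKernel_of_nonpos h1, zero_mul]
    · rw [hP0, mul_zero]
      by_contra h2
      exact h ⟨h1, by linarith⟩

lemma abs_integral_powKernel_mul_le {e a z M : ℝ} (he : -1 < e) (hz : a ≤ z)
    {P : ℝ → ℝ} (hPM : ∀ x, |P x| ≤ M) (hP0 : ∀ x ≤ a, P x = 0) :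
    |∫ s, powKernel e (z - s) * P s| ≤ (z - a) ^ (e + 1) / (e + 1) * M := by
  have hz' : 0 ≤ z - a := sub_nonneg.2 hz
  rw [integral_powKernel_mul_eq_intervalIntegral hz' (by linarith) hP0]
  have h := intervalIntegral.norm_integral_le_of_norm_le (μ := volume) hz'
    (f := fun r => r ^ e * P (z - r)) (g := fun r => r ^ e * M)
    (Eventually.of_forall fun r hr => by
      rw [norm_mul, Real.norm_of_nonneg (Real.rpow_nonneg hr.1.le _)]
      exact mul_le_mul_of_nonneg_left (hPM _) (Real.rpow_nonneg hr.1.le _))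
    ((intervalIntegral.intervalIntegrable_rpow' he).mul_const M)
  rw [intervalIntegral.integral_mul_const, integral_rpow (Or.inl he),
    Real.zero_rpow (by linarith), sub_zero] at h
  exact h

lemma exists_abs_derivWithin_le {u : ℝ → ℝ} {a b : ℝ} (hab : a < b)
    (hu : ContDiffOn ℝ 1 u (Icc a b)) : ∃ M, ∀ x ∈ Icc a b, |derivWithin u (Icc a b) x| ≤ M :=
  isCompact_Icc.exists_bound_of_continuousOn
    (hu.continuousOn_derivWithin (uniqueDiffOn_Icc hab) le_rfl)

lemma hasDerivAt_of_contDiffOn_Icc {u : ℝ → ℝ} {a b : ℝ}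
    (hu : ContDiffOn ℝ 1 u (Icc a b)) {x : ℝ} (hx : x ∈ Ioo a b) :
    HasDerivAt u (deriv u x) x :=
  ((hu.differentiableOn one_ne_zero x (Ioo_subset_Icc_self hx)).differentiableAt
    (Icc_mem_nhds hx.1 hx.2)).hasDerivAt

lemma exists_abs_indicator_deriv_le {u : ℝ → ℝ} {a b : ℝ} (hab : a < b)
    (hu : ContDiffOn ℝ 1 u (Icc a b)) : ∃ M, ∀ x, |(Ioo a b).indicator (deriv u) x| ≤ M := by
  obtain ⟨M, hM⟩ := exists_abs_derivWithin_le hab hu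
  refine ⟨M, fun x => ?_⟩
  by_cases hx : x ∈ Ioo a b
  · rw [indicator_of_mem hx, ← derivWithin_of_mem_nhds (Icc_mem_nhds hx.1 hx.2)]
    exact hM x (Ioo_subset_Icc_self hx)
  · rw [indicator_of_notMem hx, abs_zero]
    exact (abs_nonneg _).trans (hM a (left_mem_Icc.2 hab.le))

lemma hasDerivAt_left_fractionalIntegral {u : ℝ → ℝ} {a b e : ℝ} (he : -1 < e)
    (hu : ContDiffOn ℝ 1 u (Icc a b)) (hua : u a = 0) {z : ℝ} (hz : z ∈ Ioo a b) :
    HasDerivAt (fun z => ∫ s in a..z, (z - s) ^ e * u s)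
      (∫ s, powKernel e (z - s) * (Ioo a b).indicator (deriv u) s) z := by
  have hab : a < b := hz.1.trans hz.2
  have hL : 0 ≤ b - a := by linarith
  obtain ⟨M, hM⟩ := exists_abs_derivWithin_le hab hu
  have hM0 : 0 ≤ M := (abs_nonneg _).trans (hM a (left_mem_Icc.2 hab.le))
  set U : ℝ → ℝ := fun x => u (projIcc a b hab.le x)
  have hU0 : ∀ x ≤ a, U x = 0 := fun x hx => by simp [U, projIcc_of_le_left hab.le hx, hua]
  have hUu : ∀ x ∈ Icc a b, U x = u x := fun x hx => by simp [U, projIcc_of_mem hab.le hx]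
  have hUlip : ∀ x y, |U x - U y| ≤ M * |x - y| := fun x y => by
    refine ((convex_Icc a b).norm_image_sub_le_of_norm_derivWithin_le
      (hu.differentiableOn one_ne_zero) hM (projIcc a b hab.le y).2
      (projIcc a b hab.le x).2).trans ?_
    have := (LipschitzWith.projIcc hab.le).dist_le_mul x y
    rw [NNReal.coe_one, one_mul] at this
    exact mul_le_mul_of_nonneg_left this hM0
  have hUc : Continuous U :=
    (LipschitzWith.of_dist_le_mul (K := ⟨M, hM0⟩) hUlip).continuous
  have hsub : ∀ w ∈ Ioo a b, ∫ s in a..w, (w - s) ^ e * u s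
      = ∫ r in (0 : ℝ)..(b - a), r ^ e * U (w - r) := fun w hw => by
    rw [← integral_powKernel_mul_eq_intervalIntegral hL (by linarith [hw.2]) hU0,
      integral_powKernel_mul_eq_intervalIntegral (L := w - a) (by linarith [hw.1]) (by linarith) hU0]
    have := intervalIntegral.integral_comp_sub_left (a := a) (b := w)
      (fun r => r ^ e * U (w - r)) w
    rw [sub_self] at this
    rw [← this]
    refine intervalIntegral.integral_congr fun s hs => ?_
    rw [uIcc_of_le hw.1.le] at hs
    simp only [sub_sub_cancel, hUu s ⟨hs.1, hs.2.trans hw.2.le⟩]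
  rw [integral_powKernel_mul_eq_intervalIntegral hL (by linarith [hz.2])
    (fun x hx => indicator_of_notMem (fun h => h.1.not_ge hx) _)]
  refine HasDerivAt.congr_of_eventuallyEq ?_
    (eventually_of_mem (Ioo_mem_nhds hz.1 hz.2) hsub)
  have hi : IntervalIntegrable (fun r : ℝ => r ^ e) volume 0 (b - a) :=
    intervalIntegral.intervalIntegrable_rpow' he
  refine (intervalIntegral.hasDerivAt_integral_of_dominated_loc_of_lip
    (F := fun w r => r ^ e * U (w - r)) (bound := fun r => r ^ e * M) univ_mem
    (Eventually.of_forall fun w => ?_) ?_ ?_ ?_ (hi.mul_const M) ?_).2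
  · have := hUc.measurable
    exact Measurable.aestronglyMeasurable (by fun_prop)
  · exact hi.mul_continuousOn (by fun_prop)
  · have := (measurable_deriv u).indicator (measurableSet_Ioo (a := a) (b := b))
    exact Measurable.aestronglyMeasurable (by fun_prop)
  · refine Eventually.of_forall fun r hr => LipschitzOnWith.of_dist_le_mul fun x _ y _ => ?_
    rw [uIoc_of_le hL] at hr
    have hr0 := Real.rpow_nonneg hr.1.le e
    rw [Real.coe_nnabs, abs_of_nonneg (mul_nonneg hr0 hM0), Real.dist_eq, Real.dist_eq, ← mul_sub,
      abs_mul, abs_of_nonneg hr0, mul_assoc]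
    have := hUlip (x - r) (y - r)
    rw [sub_sub_sub_cancel_right] at this
    exact mul_le_mul_of_nonneg_left this hr0
  · have hne : ∀ᵐ r : ℝ, r ≠ z - a := by simp [ae_iff]
    filter_upwards [hne] with r hr hr'
    rw [uIoc_of_le hL] at hr'
    refine HasDerivAt.const_mul _ ?_
    refine HasDerivAt.comp_sub_const z r ?_
    rcases lt_or_gt_of_ne hr with h | h
    · have hm : z - r ∈ Ioo a b := ⟨by linarith, by linarith [hr'.1, hz.2]⟩
      rw [indicator_of_mem hm]
      exact (hasDerivAt_of_contDiffOn_Icc hu hm).congr_of_eventuallyEq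
        (eventually_of_mem (Ioo_mem_nhds hm.1 hm.2) fun x hx => hUu x (Ioo_subset_Icc_self hx))
    · have hm : z - r < a := by linarith
      rw [indicator_of_notMem (fun h => h.1.not_gt hm)]
      exact (hasDerivAt_const _ (0 : ℝ)).congr_of_eventuallyEq
        (eventually_of_mem (Iio_mem_nhds hm) fun x hx => hU0 x (le_of_lt hx))

lemma contDiffOn_comp_reflect {u : ℝ → ℝ} {a b : ℝ} {n : WithTop ℕ∞}
    (hu : ContDiffOn ℝ n u (Icc a b)) : ContDiffOn ℝ n (fun t => u (a + b - t)) (Icc a b) :=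
  hu.comp (contDiff_const.sub contDiff_id).contDiffOn
    (fun t ht => ⟨by linarith [ht.2], by linarith [ht.1]⟩)

lemma intervalIntegral_reflect_left (v : ℝ → ℝ) (a b e z : ℝ) :
    ∫ s in a..z, (z - s) ^ e * v (a + b - s) =
      ∫ s in (a + b - z)..b, (s - (a + b - z)) ^ e * v s := by
  have := intervalIntegral.integral_comp_sub_left (a := a) (b := z)
    (fun s => (s - (a + b - z)) ^ e * v s) (a + b)
  rw [add_sub_cancel_left] at this
  rw [← this]
  refine intervalIntegral.integral_congr fun s _ => ?_
  congr 2; ring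

lemma hasDerivAt_right_fractionalIntegral {v : ℝ → ℝ} {a b e : ℝ} (he : -1 < e)
    (hv : ContDiffOn ℝ 1 v (Icc a b)) (hvb : v b = 0) {z : ℝ} (hz : z ∈ Ioo a b) :
    HasDerivAt (fun z => ∫ s in z..b, (s - z) ^ e * v s)
      (∫ s, powKernel e (s - z) * (Ioo a b).indicator (deriv v) s) z := by
  have hz' : a + b - z ∈ Ioo a b := ⟨by linarith [hz.2], by linarith [hz.1]⟩
  have h := hasDerivAt_left_fractionalIntegral he (contDiffOn_comp_reflect hv) (by simpa) hz'
  simp only [intervalIntegral_reflect_left] at h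
  have h2 := h.comp_const_sub (a + b) z
  simp only [sub_sub_cancel] at h2
  refine h2.congr_deriv ?_
  rw [← integral_neg, ← integral_sub_left_eq_self _ volume (a + b)]
  congr 1; ext s
  rw [show a + b - z - (a + b - s) = s - z by ring, ← mul_neg]
  congr 1
  by_cases hs : s ∈ Ioo a b
  · have hs' : a + b - s ∈ Ioo a b := ⟨by linarith [hs.2], by linarith [hs.1]⟩
    rw [indicator_of_mem hs, indicator_of_mem hs', deriv_comp_const_sub, sub_sub_cancel, neg_neg]
  · have hs' : a + b - s ∉ Ioo a b := fun h => hs ⟨by linarith [h.2], by linarith [h.1]⟩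
    rw [indicator_of_notMem hs, indicator_of_notMem hs', neg_zero]

theorem setIntegral_left_fractional_parts {a b β : ℝ} (hab : a < b) (hβ2 : β < 2)
    {u v G1 G1' G2 G3 : ℝ → ℝ}
    (hu : ContDiffOn ℝ 1 u (Icc a b)) (hua : u a = 0)
    (hv : ContDiffOn ℝ 1 v (Icc a b)) (hvb : v b = 0)
    (hG1 : ∀ t ∈ Ioo a b,
      HasDerivAt (fun z => ∫ s in a..z, (z - s) ^ (1 - β) * u s) (G1 t) t)
    (hG1' : ∀ t ∈ Ioo a b, HasDerivAt G1 (G1' t) t)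
    (hG2 : ∀ t ∈ Ioo a b,
      HasDerivAt (fun z => ∫ s in a..z, (z - s) ^ (-(β / 2)) * u s) (G2 t) t)
    (hG3 : ∀ t ∈ Ioo a b,
      HasDerivAt (fun z => ∫ s in z..b, (s - z) ^ (-(β / 2)) * v s) (G3 t) t)
    (hint : IntegrableOn (fun t => (1 / Real.Gamma (2 - β)) * G1' t * v t) (Ioo a b)) :
    ∫ t in Ioo a b, (1 / Real.Gamma (2 - β)) * G1' t * v t =
      ∫ t in Ioo a b,
        ((1 / Real.Gamma (1 - β / 2)) * G2 t) * ((-1 / Real.Gamma (1 - β / 2)) * G3 t) := by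
  have hΓ1 : Real.Gamma (2 - β) ≠ 0 := (Real.Gamma_pos_of_pos (by linarith)).ne'
  have hΓ2 : Real.Gamma (1 - β / 2) ≠ 0 := (Real.Gamma_pos_of_pos (by linarith)).ne'
  have he1 : -1 < 1 - β := by linarith
  have he2 : -1 < -(β / 2) := by linarith
  obtain ⟨M, hM⟩ := exists_abs_indicator_deriv_le hab hu
  obtain ⟨N, hN⟩ := exists_abs_indicator_deriv_le hab hv
  set P := (Ioo a b).indicator (deriv u) with hPdef
  set Q := (Ioo a b).indicator (deriv v) with hQdef
  have hPm : Measurable P := (measurable_deriv u).indicator measurableSet_Ioo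
  have hQm : Measurable Q := (measurable_deriv v).indicator measurableSet_Ioo
  have hP0 : ∀ x ∉ Ioo a b, P x = 0 := fun x hx => indicator_of_notMem hx _
  have hQ0 : ∀ x ∉ Ioo a b, Q x = 0 := fun x hx => indicator_of_notMem hx _
  have hPa : ∀ x ≤ a, P x = 0 := fun x hx => hP0 x fun h => h.1.not_ge hx
  have hF1 : ∀ t ∈ Ioo a b, G1 t = ∫ s, powKernel (1 - β) (t - s) * P s := fun t ht =>
    (hG1 t ht).unique (hasDerivAt_left_fractionalIntegral he1 hu hua ht)
  have hF2 : ∀ t ∈ Ioo a b, G2 t = ∫ s, powKernel (-(β / 2)) (t - s) * P s := fun t ht =>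
    (hG2 t ht).unique (hasDerivAt_left_fractionalIntegral he2 hu hua ht)
  have hF3 : ∀ t ∈ Ioo a b, G3 t = ∫ s, powKernel (-(β / 2)) (s - t) * Q s := fun t ht =>
    (hG3 t ht).unique (hasDerivAt_right_fractionalIntegral he2 hv hvb ht)
  have hG1le : ∀ t ∈ Ioo a b, |G1 t| ≤ (t - a) ^ (1 - β + 1) / (1 - β + 1) * M := fun t ht => by
    rw [hF1 t ht]
    exact abs_integral_powKernel_mul_le he1 ht.1.le hM hPa
  have hM0 : 0 ≤ M := (abs_nonneg _).trans (hM a)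
  set C := (b - a) ^ (1 - β + 1) / (1 - β + 1) * M
  have hG1C : ∀ t ∈ Ioo a b, |G1 t| ≤ C := fun t ht => (hG1le t ht).trans <| by
    have h1 : (t - a) ^ (1 - β + 1) ≤ (b - a) ^ (1 - β + 1) :=
      Real.rpow_le_rpow (by linarith [ht.1]) (by linarith [ht.2]) (by linarith)
    have h2 : 0 ≤ 1 - β + 1 := by linarith
    exact mul_le_mul_of_nonneg_right (div_le_div_of_nonneg_right h1 h2) hM0
  have hi1 : IntegrableOn (fun t => G1' t * v t) (Ioo a b) := by
    have := hint.const_mul (Real.Gamma (2 - β))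
    refine this.congr (Eventually.of_forall fun t => ?_)
    simp only; field_simp
  have hi2 : IntegrableOn (fun t => G1 t * Q t) (Ioo a b) := by
    have hc : ContinuousOn G1 (Ioo a b) := fun t ht =>
      (hG1' t ht).continuousAt.continuousWithinAt
    refine Integrable.mono' (g := fun _ => C * N) (integrableOn_const (by simp))
      ((hc.aestronglyMeasurable measurableSet_Ioo).mul hQm.aestronglyMeasurable) ?_
    refine (ae_restrict_iff' measurableSet_Ioo).2 (Eventually.of_forall fun t ht => ?_)
    rw [norm_mul]
    exact mul_le_mul (hG1C t ht) (hN t) (norm_nonneg _) ((abs_nonneg _).trans (hG1C t ht))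
  have hcv : ContinuousOn v (Icc a b) := hv.continuousOn
  have hva : Tendsto v (𝓝[>] a) (𝓝 (v a)) :=
    ((hcv a (left_mem_Icc.2 hab.le)).mono Ioo_subset_Icc_self).tendsto.mono_left
      (nhdsWithin_Ioo_eq_nhdsGT hab).ge
  have hvb' : Tendsto v (𝓝[<] b) (𝓝 0) := by
    rw [← hvb]
    exact ((hcv b (right_mem_Icc.2 hab.le)).mono Ioo_subset_Icc_self).tendsto.mono_left
      (nhdsWithin_Ioo_eq_nhdsLT hab).ge
  have hG1a : Tendsto G1 (𝓝[>] a) (𝓝 0) := by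
    refine squeeze_zero_norm' (a := fun t => (t - a) ^ (1 - β + 1) / (1 - β + 1) * M)
      (eventually_of_mem (Ioo_mem_nhdsGT hab) hG1le) ?_
    have hcont : ContinuousAt (fun t => (t - a) ^ (1 - β + 1) / (1 - β + 1) * M) a := by
      refine ContinuousAt.mul (ContinuousAt.div_const ?_ _) continuousAt_const
      exact ContinuousAt.rpow_const (by fun_prop) (Or.inr (by linarith))
    have := hcont.tendsto
    simp only [sub_self] at this
    rw [Real.zero_rpow (by linarith), zero_div, zero_mul] at this
    exact this.mono_left nhdsWithin_le_nhds
  have hbd : Tendsto (fun t => G1 t * v t) (𝓝[<] b) (𝓝 0) := by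
    refine squeeze_zero_norm' (a := fun t => C * |v t|) ?_ ?_
    · refine eventually_of_mem (Ioo_mem_nhdsLT hab) fun t ht => ?_
      rw [norm_mul]
      exact mul_le_mul_of_nonneg_right (hG1C t ht) (norm_nonneg _)
    · simpa using hvb'.abs.const_mul C
  have hparts : ∫ t in Ioo a b, G1' t * v t = -∫ t in Ioo a b, G1 t * Q t := by
    have h := intervalIntegral.integral_eq_sub_of_hasDerivAt_of_tendsto hab
      (f := fun t => G1 t * v t) (f' := fun t => G1' t * v t + G1 t * Q t)
      (fun t ht => by
        rw [hQdef, indicator_of_mem ht]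
        exact (hG1' t ht).mul (hasDerivAt_of_contDiffOn_Icc hv ht))
      ((intervalIntegrable_iff_integrableOn_Ioo_of_le hab.le).2 (hi1.add hi2))
      (by simpa using hG1a.mul hva) hbd
    rw [intervalIntegral.integral_of_le hab.le, integral_Ioc_eq_integral_Ioo,
      integral_add hi1 hi2, sub_zero] at h
    linarith
  have hkey := integral_powKernel_convolution_mul he2 hPm hM hP0 hQm hN hQ0
  have e1 : 2 * -(β / 2) + 1 = 1 - β := by ring
  have e2 : 2 * -(β / 2) + 2 = 2 - β := by ring
  have e3 : -(β / 2) + 1 = 1 - β / 2 := by ring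
  rw [e1, e2, e3] at hkey
  have hR : ∫ t in Ioo a b, G1 t * Q t
      = ∫ t, (∫ s, powKernel (1 - β) (t - s) * P s) * Q t := by
    refine (setIntegral_congr_fun measurableSet_Ioo fun t ht => ?_).trans
      (setIntegral_eq_integral_of_forall_compl_eq_zero
        (fun t ht => by rw [hQ0 t ht, mul_zero]))
    simp only [hF1 t ht]
  have hL : ∫ t in Ioo a b, G2 t * G3 t = ∫ z, (∫ s, powKernel (-(β / 2)) (z - s) * P s) *
      (∫ t, powKernel (-(β / 2)) (t - z) * Q t) := by
    refine (setIntegral_congr_fun measurableSet_Ioo fun t ht => ?_).trans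
      (setIntegral_eq_integral_of_forall_compl_eq_zero fun z hz => ?_)
    · simp only [hF2 t ht, hF3 t ht]
    · rw [mul_eq_zero]
      rcases le_or_gt z a with h | h
      · have : ∀ s, powKernel (-(β / 2)) (z - s) * P s = 0 := fun s => by
          rcases le_or_gt s a with hs | hs
          · rw [hPa s hs, mul_zero]
          · rw [powKernel_of_nonpos (by linarith), zero_mul]
        simp [this]
      · have hzb : b ≤ z := not_lt.1 fun h' => hz ⟨h, h'⟩
        have : ∀ s, powKernel (-(β / 2)) (s - z) * Q s = 0 := fun s => by
          rcases le_or_gt b s with hs | hs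
          · rw [hQ0 s fun h => h.2.not_ge hs, mul_zero]
          · rw [powKernel_of_nonpos (by linarith), zero_mul]
        simp [this]
  calc _ = (1 / Real.Gamma (2 - β)) * ∫ t in Ioo a b, G1' t * v t := by
        rw [← integral_const_mul]; simp only [mul_assoc]
    _ = (-1 / Real.Gamma (1 - β / 2) ^ 2) * ∫ t in Ioo a b, G2 t * G3 t := by
        rw [hparts, hR, hL, hkey]
        generalize Real.Gamma (1 - β / 2) = g at hΓ2 ⊢
        field_simp
    _ = _ := by
        rw [← integral_const_mul]
        congr 1; ext t; field_simp

lemma integrableOn_Ioo_reflect {a b : ℝ} {f : ℝ → ℝ} (hf : IntegrableOn f (Ioo a b)) :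
    IntegrableOn (fun t => f (a + b - t)) (Ioo a b) := by
  rw [← integrable_indicator_iff measurableSet_Ioo] at hf ⊢
  refine (hf.comp_sub_left (a + b)).congr (Eventually.of_forall fun t => ?_)
  have : a + b - t ∈ Ioo a b ↔ t ∈ Ioo a b :=
    ⟨fun h => ⟨by linarith [h.2], by linarith [h.1]⟩, fun h => ⟨by linarith [h.2], by linarith [h.1]⟩⟩
  simp only [indicator, this]

lemma setIntegral_Ioo_reflect (a b : ℝ) (f : ℝ → ℝ) :
    ∫ t in Ioo a b, f (a + b - t) = ∫ t in Ioo a b, f t := by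
  rw [← integral_indicator measurableSet_Ioo, ← integral_indicator measurableSet_Ioo,
    ← integral_sub_left_eq_self ((Ioo a b).indicator f) volume (a + b)]
  congr 1; ext t
  have : a + b - t ∈ Ioo a b ↔ t ∈ Ioo a b :=
    ⟨fun h => ⟨by linarith [h.2], by linarith [h.1]⟩, fun h => ⟨by linarith [h.2], by linarith [h.1]⟩⟩
  simp only [indicator, this]

lemma intervalIntegral_reflect_right (v : ℝ → ℝ) (a b e z : ℝ) :
    ∫ s in z..b, (s - z) ^ e * v (a + b - s) =
      ∫ s in a..(a + b - z), (a + b - z - s) ^ e * v s := by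
  have := intervalIntegral.integral_comp_sub_left (a := z) (b := b)
    (fun s => (a + b - z - s) ^ e * v s) (a + b)
  rw [add_sub_cancel_right] at this
  rw [← this]
  refine intervalIntegral.integral_congr fun s _ => ?_
  congr 2; ring

theorem setIntegral_right_fractional_parts {a b β : ℝ} (hab : a < b) (hβ2 : β < 2)
    {u v H1 H1' H2 H3 : ℝ → ℝ}
    (hu : ContDiffOn ℝ 1 u (Icc a b)) (hub : u b = 0)
    (hv : ContDiffOn ℝ 1 v (Icc a b)) (hva : v a = 0)
    (hH1 : ∀ t ∈ Ioo a b,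
      HasDerivAt (fun z => ∫ s in z..b, (s - z) ^ (1 - β) * u s) (H1 t) t)
    (hH1' : ∀ t ∈ Ioo a b, HasDerivAt H1 (H1' t) t)
    (hH2 : ∀ t ∈ Ioo a b,
      HasDerivAt (fun z => ∫ s in z..b, (s - z) ^ (-(β / 2)) * u s) (H2 t) t)
    (hH3 : ∀ t ∈ Ioo a b,
      HasDerivAt (fun z => ∫ s in a..z, (z - s) ^ (-(β / 2)) * v s) (H3 t) t)
    (hint : IntegrableOn (fun t => (1 / Real.Gamma (2 - β)) * H1' t * v t) (Ioo a b)) :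
    ∫ t in Ioo a b, (1 / Real.Gamma (2 - β)) * H1' t * v t =
      ∫ t in Ioo a b,
        ((-1 / Real.Gamma (1 - β / 2)) * H2 t) * ((1 / Real.Gamma (1 - β / 2)) * H3 t) := by
  have hm : ∀ t ∈ Ioo a b, a + b - t ∈ Ioo a b := fun t ht =>
    ⟨by linarith [ht.2], by linarith [ht.1]⟩
  have h := setIntegral_left_fractional_parts hab hβ2 (u := fun t => u (a + b - t))
    (v := fun t => v (a + b - t)) (G1 := fun t => -H1 (a + b - t))
    (G1' := fun t => H1' (a + b - t)) (G2 := fun t => -H2 (a + b - t))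
    (G3 := fun t => -H3 (a + b - t)) (contDiffOn_comp_reflect hu) (by simpa)
    (contDiffOn_comp_reflect hv) (by simpa)
    (fun t ht => by
      simp only [intervalIntegral_reflect_left]
      exact (hH1 _ (hm t ht)).comp_const_sub (a + b) t)
    (fun t ht => by
      exact ((hH1' _ (hm t ht)).comp_const_sub (a + b) t).fun_neg.congr_deriv (neg_neg _))
    (fun t ht => by
      simp only [intervalIntegral_reflect_left]
      exact (hH2 _ (hm t ht)).comp_const_sub (a + b) t)
    (fun t ht => by
      simp only [intervalIntegral_reflect_right]
      exact (hH3 _ (hm t ht)).comp_const_sub (a + b) t)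
    (integrableOn_Ioo_reflect hint)
  rw [setIntegral_Ioo_reflect a b (fun t => (1 / Real.Gamma (2 - β)) * H1' t * v t),
    setIntegral_Ioo_reflect a b (fun t => ((1 / Real.Gamma (1 - β / 2)) * -H2 t) *
      ((-1 / Real.Gamma (1 - β / 2)) * -H3 t))] at h
  rw [h]
  congr 1; ext t; ring

lemma indicator_pi_Ioo_insertNth {n : ℕ} (a b : Fin (n + 1) → ℝ) (j : Fin (n + 1))
    (f : (Fin (n + 1) → ℝ) → ℝ) (t : ℝ) (w : Fin n → ℝ) :
    (univ.pi fun i => Ioo (a i) (b i)).indicator f (j.insertNth t w) =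
      (univ.pi fun i => Ioo (a (j.succAbove i)) (b (j.succAbove i))).indicator
        (fun w => (Ioo (a j) (b j)).indicator (fun t => f (j.insertNth t w)) t) w := by
  simp only [indicator, mem_univ_pi, Fin.forall_iff_succAbove j, Fin.insertNth_apply_same,
    Fin.insertNth_apply_succAbove]
  split_ifs <;> tauto

/-- Integrals over a box agree if they agree on almost every line in direction `j`. -/
theorem setIntegral_pi_Ioo_congr_of_update {d : ℕ} (a b : Fin d → ℝ) (j : Fin d)
    {f g : (Fin d → ℝ) → ℝ}
    (hf : IntegrableOn f (univ.pi fun i => Ioo (a i) (b i)))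
    (hg : IntegrableOn g (univ.pi fun i => Ioo (a i) (b i)))
    (h : ∀ y : Fin d → ℝ, IntegrableOn (fun t => f (Function.update y j t)) (Ioo (a j) (b j)) →
      ∫ t in Ioo (a j) (b j), f (Function.update y j t) =
        ∫ t in Ioo (a j) (b j), g (Function.update y j t)) :
    ∫ y in univ.pi fun i => Ioo (a i) (b i), f y =
      ∫ y in univ.pi fun i => Ioo (a i) (b i), g y := by
  cases d with
  | zero => exact j.elim0
  | succ n =>
    have hS : MeasurableSet (univ.pi fun i => Ioo (a i) (b i)) :=
      MeasurableSet.univ_pi fun i => measurableSet_Ioo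
    let φ := MeasurableEquiv.piFinSuccAbove (fun _ : Fin (n + 1) => ℝ) j
    have hφ : MeasurePreserving φ.symm (volume.prod volume) volume :=
      (volume_preserving_piFinSuccAbove (fun _ : Fin (n + 1) => ℝ) j).symm
    have hins : ∀ (t : ℝ) (w : Fin n → ℝ), φ.symm (t, w) = j.insertNth t w := fun _ _ => rfl
    rw [← integrable_indicator_iff hS, ← hφ.integrable_comp_emb φ.symm.measurableEmbedding]
      at hf hg
    rw [← integral_indicator hS, ← integral_indicator hS, ← hφ.integral_comp',
      ← hφ.integral_comp']
    refine (integral_prod_symm _ hf).trans (Eq.trans ?_ (integral_prod_symm _ hg).symm)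
    refine integral_congr_ae ?_
    filter_upwards [hf.prod_left_ae] with w hw
    simp only [Function.comp, hins, indicator_pi_Ioo_insertNth] at hw ⊢
    by_cases hmem : w ∈ univ.pi fun i => Ioo (a (j.succAbove i)) (b (j.succAbove i))
    · simp only [indicator_of_mem hmem] at hw ⊢
      rw [integral_indicator measurableSet_Ioo, integral_indicator measurableSet_Ioo]
      have hu : ∀ t, Function.update (j.insertNth (0 : ℝ) w : Fin (n + 1) → ℝ) j t =
          j.insertNth t w := fun t => by simp
      have := h (j.insertNth 0 w)
      simp only [hu] at this
      exact this ((integrable_indicator_iff measurableSet_Ioo).1 hw)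
    · simp only [indicator_of_notMem hmem]


/-- Lemma 2.6 of the paper.
Two-sided fractional integration by parts on a bounded open box
`Λ = ∏_{i} (a i, b i) ⊆ ℝ^d`, in the `j`-th coordinate, for `1 < β < 2`.
The one-dimensional fractional derivatives in `x_j` (other coordinates frozen) are
encoded through their defining derivatives: `G1`, `G1'` (first and second derivative of
`z ↦ ∫_{a_j}^z (z-s)^{1-β} u ds`, so `D_{a_j+}^β u = (1/Γ(2-β)) G1'`), `G2`
(`D_{a_j+}^{β/2} u = (1/Γ(1-β/2)) G2`) and `G3` (`D_{b_j-}^{β/2} v = (-1/Γ(1-β/2)) G3`);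
mirrored data `H1, H1', H2, H3` for the symmetric claim. Then
`∫_Λ (D_{a_j+}^β u) v = ∫_Λ (D_{a_j+}^{β/2} u)(D_{b_j-}^{β/2} v)` under the first set of
hypotheses, and symmetrically
`∫_Λ (D_{b_j-}^β u) v = ∫_Λ (D_{b_j-}^{β/2} u)(D_{a_j+}^{β/2} v)`. -/
theorem stmt10 (d : ℕ) (hd : 1 ≤ d) (a b : Fin d → ℝ) (hab : ∀ i, a i < b i)
    (j : Fin d) (β : ℝ) (hβ1 : 1 < β) (hβ2 : β < 2)
    (u v : (Fin d → ℝ) → ℝ) :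
    (∀ G1 G1' G2 G3 : (Fin d → ℝ) → ℝ,
      (∀ y : Fin d → ℝ,
        ContDiffOn ℝ 2 (fun t => u (Function.update y j t)) (Set.Icc (a j) (b j))) →
      (∀ y : Fin d → ℝ, u (Function.update y j (a j)) = 0) →
      (∀ y : Fin d → ℝ,
        ContDiffOn ℝ 1 (fun t => v (Function.update y j t)) (Set.Icc (a j) (b j))) →
      (∀ y : Fin d → ℝ, v (Function.update y j (b j)) = 0) →
      (∀ y : Fin d → ℝ, ∀ t ∈ Set.Ioo (a j) (b j),
        HasDerivAt (fun z => ∫ s in (a j)..z, (z - s) ^ (1 - β) * u (Function.update y j s))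
          (G1 (Function.update y j t)) t) →
      (∀ y : Fin d → ℝ, ∀ t ∈ Set.Ioo (a j) (b j),
        HasDerivAt (fun z => G1 (Function.update y j z)) (G1' (Function.update y j t)) t) →
      (∀ y : Fin d → ℝ, ∀ t ∈ Set.Ioo (a j) (b j),
        HasDerivAt (fun z => ∫ s in (a j)..z, (z - s) ^ (-(β/2)) * u (Function.update y j s))
          (G2 (Function.update y j t)) t) →
      (∀ y : Fin d → ℝ, ∀ t ∈ Set.Ioo (a j) (b j),
        HasDerivAt (fun z => ∫ s in z..(b j), (s - z) ^ (-(β/2)) * v (Function.update y j s))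
          (G3 (Function.update y j t)) t) →
      MeasureTheory.IntegrableOn (fun y => (1 / Real.Gamma (2 - β)) * G1' y * v y)
        (Set.univ.pi fun i => Set.Ioo (a i) (b i)) →
      MeasureTheory.IntegrableOn
        (fun y => ((1 / Real.Gamma (1 - β/2)) * G2 y) * ((-1 / Real.Gamma (1 - β/2)) * G3 y))
        (Set.univ.pi fun i => Set.Ioo (a i) (b i)) →
      (∫ y in Set.univ.pi fun i => Set.Ioo (a i) (b i),
          (1 / Real.Gamma (2 - β)) * G1' y * v y)
        = ∫ y in Set.univ.pi fun i => Set.Ioo (a i) (b i),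
            ((1 / Real.Gamma (1 - β/2)) * G2 y) * ((-1 / Real.Gamma (1 - β/2)) * G3 y))
    ∧
    (∀ H1 H1' H2 H3 : (Fin d → ℝ) → ℝ,
      (∀ y : Fin d → ℝ,
        ContDiffOn ℝ 2 (fun t => u (Function.update y j t)) (Set.Icc (a j) (b j))) →
      (∀ y : Fin d → ℝ, u (Function.update y j (b j)) = 0) →
      (∀ y : Fin d → ℝ,
        ContDiffOn ℝ 1 (fun t => v (Function.update y j t)) (Set.Icc (a j) (b j))) →
      (∀ y : Fin d → ℝ, v (Function.update y j (a j)) = 0) →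
      (∀ y : Fin d → ℝ, ∀ t ∈ Set.Ioo (a j) (b j),
        HasDerivAt (fun z => ∫ s in z..(b j), (s - z) ^ (1 - β) * u (Function.update y j s))
          (H1 (Function.update y j t)) t) →
      (∀ y : Fin d → ℝ, ∀ t ∈ Set.Ioo (a j) (b j),
        HasDerivAt (fun z => H1 (Function.update y j z)) (H1' (Function.update y j t)) t) →
      (∀ y : Fin d → ℝ, ∀ t ∈ Set.Ioo (a j) (b j),
        HasDerivAt (fun z => ∫ s in z..(b j), (s - z) ^ (-(β/2)) * u (Function.update y j s))
          (H2 (Function.update y j t)) t) →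
      (∀ y : Fin d → ℝ, ∀ t ∈ Set.Ioo (a j) (b j),
        HasDerivAt (fun z => ∫ s in (a j)..z, (z - s) ^ (-(β/2)) * v (Function.update y j s))
          (H3 (Function.update y j t)) t) →
      MeasureTheory.IntegrableOn (fun y => (1 / Real.Gamma (2 - β)) * H1' y * v y)
        (Set.univ.pi fun i => Set.Ioo (a i) (b i)) →
      MeasureTheory.IntegrableOn
        (fun y => ((-1 / Real.Gamma (1 - β/2)) * H2 y) * ((1 / Real.Gamma (1 - β/2)) * H3 y))
        (Set.univ.pi fun i => Set.Ioo (a i) (b i)) →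
      (∫ y in Set.univ.pi fun i => Set.Ioo (a i) (b i),
          (1 / Real.Gamma (2 - β)) * H1' y * v y)
        = ∫ y in Set.univ.pi fun i => Set.Ioo (a i) (b i),
            ((-1 / Real.Gamma (1 - β/2)) * H2 y) * ((1 / Real.Gamma (1 - β/2)) * H3 y)) := by
  refine ⟨fun G1 G1' G2 G3 hu hua hv hvb h1 h1' h2 h3 hf hg => ?_,
    fun H1 H1' H2 H3 hu hub hv hva h1 h1' h2 h3 hf hg => ?_⟩
  · exact setIntegral_pi_Ioo_congr_of_update a b j hf hg fun y hy =>
      setIntegral_left_fractional_parts (hab j) hβ2 ((hu y).of_le one_le_two) (hua y)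
        (hv y) (hvb y) (h1 y) (h1' y) (h2 y) (h3 y) hy
  · exact setIntegral_pi_Ioo_congr_of_update a b j hf hg fun y hy =>
      setIntegral_right_fractional_parts (hab j) hβ2 ((hu y).of_le one_le_two) (hub y)
        (hv y) (hva y) (h1 y) (h1' y) (h2 y) (h3 y) hy
end

section
/- Let 0 < ν < 1, let a < b be reals, and let v : [a,b] → ℝ be continuously differentiable with v(b) = 0. Then for every s ∈ (a,b), the function s ↦ ∫_s^b v(x)·(x−s)^{−ν} dx is differentiable at s and d/ds ∫_s^b v(x)·(x−s)^{−ν} dx = ∫_s^b v′(x)·(x−s)^{−ν} dx. -/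
open MeasureTheory Set Filter Topology in
/-- A weakly singular integral of a Lipschitz function is differentiable in the shift parameter,
and the derivative passes onto the function. -/
theorem hasDerivAt_integral_shift_mul_rpow {p : ℝ} (hp : -1 < p) {K : NNReal} {w : ℝ → ℝ}
    (hw : LipschitzWith K w) {c : ℝ} (hc : 0 ≤ c) (s : ℝ) :
    HasDerivAt (fun r => ∫ u in (0 : ℝ)..c, w (u + r) * u ^ p)
      (∫ u in (0 : ℝ)..c, deriv w (u + s) * u ^ p) s := by
  have hint : IntervalIntegrable (fun u : ℝ => u ^ p) volume 0 c :=
    intervalIntegral.intervalIntegrable_rpow' hp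
  have hF (r : ℝ) : IntervalIntegrable (fun u => w (u + r) * u ^ p) volume 0 c :=
    hint.continuousOn_mul (hw.continuous.comp (continuous_add_const r)).continuousOn
  have hdiff : ∀ᵐ u : ℝ, DifferentiableAt ℝ w (u + s) :=
    (measurePreserving_add_right volume s).quasiMeasurePreserving.ae hw.ae_differentiableAt
  refine (intervalIntegral.hasDerivAt_integral_of_dominated_loc_of_lip
    (bound := fun u => K * u ^ p) (s := univ) univ_mem
    (Eventually.of_forall fun r => ?_) (hF s) ?_ (ae_of_all _ fun u hu => ?_)
    (hint.const_mul _) (hdiff.mono fun u hu _ => ?_)).2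
  · simpa only [uIoc_of_le hc] using (hF r).1.aestronglyMeasurable
  · exact (((measurable_deriv w).comp (measurable_add_const s)).mul
      (measurable_id.pow_const p)).aestronglyMeasurable
  · rw [uIoc_of_le hc] at hu
    have hup : 0 ≤ u ^ p := Real.rpow_nonneg hu.1.le p
    refine LipschitzOnWith.of_dist_le_mul fun x _ y _ => ?_
    have h := hw.dist_le_mul (u + x) (u + y)
    rw [dist_add_left, Real.dist_eq] at h
    rw [Real.coe_nnabs, abs_of_nonneg (mul_nonneg K.coe_nonneg hup), Real.dist_eq, ← sub_mul,
      abs_mul, abs_of_nonneg hup, mul_right_comm]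
    exact mul_le_mul_of_nonneg_right h hup
  · exact (hu.hasDerivAt.comp_const_add u s).mul_const _

open MeasureTheory Set in
/-- The shift `x = u + r` in a weakly singular integral of a function vanishing beyond `b`. -/
theorem integral_shift_mul_rpow_eq {p : ℝ} {f g : ℝ → ℝ} {r b c : ℝ} (hrb : r ≤ b)
    (hc : b - r ≤ c) (hfg : ∀ x ∈ Ioo r b, f x = g x) (hf : ∀ x, b < x → f x = 0) :
    ∫ u in (0 : ℝ)..c, f (u + r) * u ^ p = ∫ x in r..b, g x * (x - r) ^ p := by
  have h0 : 0 ≤ b - r := sub_nonneg.2 hrb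
  calc ∫ u in (0 : ℝ)..c, f (u + r) * u ^ p
      = ∫ u in (0 : ℝ)..(b - r), f (u + r) * u ^ p := by
        rw [intervalIntegral.integral_of_le h0, intervalIntegral.integral_of_le (h0.trans hc)]
        refine setIntegral_eq_of_subset_of_forall_sdiff_eq_zero measurableSet_Ioc
          (Ioc_subset_Ioc_right hc) fun u hu => ?_
        have hu' : b - r < u := not_le.1 fun h => hu.2 ⟨hu.1.1, h⟩
        rw [hf _ (by linarith), zero_mul]
    _ = ∫ x in r..b, f x * (x - r) ^ p := by
        rw [← sub_self r, ← intervalIntegral.integral_comp_sub_right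
          (fun u => f (u + r) * u ^ p) r]
        simp only [sub_add_cancel]
    _ = ∫ x in r..b, g x * (x - r) ^ p :=
        intervalIntegral.integral_congr_Ioo_of_le hrb fun x hx => by
          simp only [hfg x hx]

open Set in
/-- A continuously differentiable function on a compact interval is Lipschitz there. -/
theorem ContDiffOn.exists_lipschitzOnWith_Icc {a b : ℝ} (hab : a < b) {v : ℝ → ℝ}
    (hv : ContDiffOn ℝ 1 v (Icc a b)) : ∃ K : NNReal, LipschitzOnWith K v (Icc a b) := by
  obtain ⟨C, hC⟩ := isCompact_Icc.exists_bound_of_continuousOn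
    (hv.continuousOn_derivWithin (uniqueDiffOn_Icc hab) le_rfl)
  exact ⟨C.toNNReal, (convex_Icc a b).lipschitzOnWith_of_nnnorm_derivWithin_le
    (hv.differentiableOn one_ne_zero) fun x hx => NNReal.le_toNNReal_of_coe_le (hC x hx)⟩


/-- key differentiation step in Appendix D of the paper.
Let `0 < ν < 1`, `a < b`, and let `v` be continuously differentiable on `[a,b]` with
`v(b) = 0`. Then for every `s ∈ (a,b)`, the map `s ↦ ∫_s^b v(x)(x-s)^{-ν} dx` is
differentiable at `s` with `d/ds ∫_s^b v(x)(x-s)^{-ν} dx = ∫_s^b v'(x)(x-s)^{-ν} dx`. -/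
theorem stmt11 (ν a b : ℝ) (hν0 : 0 < ν) (hν1 : ν < 1) (hab : a < b)
    (v : ℝ → ℝ) (hv : ContDiffOn ℝ 1 v (Set.Icc a b)) (hvb : v b = 0) :
    ∀ s ∈ Set.Ioo a b,
      HasDerivAt (fun r => ∫ x in r..b, v x * (x - r) ^ (-ν))
        (∫ x in s..b, derivWithin v (Set.Icc a b) x * (x - s) ^ (-ν)) s := by
  intro s hs
  obtain ⟨K, hK⟩ := hv.exists_lipschitzOnWith_Icc hab
  set w : ℝ → ℝ := Set.IccExtend hab.le ((Set.Icc a b).domRestrict v) with hw_def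
  have hw : LipschitzWith (K * 1) w := hK.to_restrict.comp (LipschitzWith.projIcc hab.le)
  have hwv : ∀ x ∈ Set.Icc a b, w x = v x := fun x hx => Set.IccExtend_of_mem hab.le _ hx
  have hw0 : ∀ x, b < x → w x = 0 := fun x hx => by
    rw [hw_def, Set.IccExtend_of_right_le hab.le _ hx.le, Set.domRestrict_apply, hvb]
  have hdw : ∀ x ∈ Set.Ioo s b, deriv w x = derivWithin v (Set.Icc a b) x := fun x hx => by
    have hmem : Set.Icc a b ∈ nhds x := Icc_mem_nhds (hs.1.trans hx.1) hx.2
    rw [derivWithin_of_mem_nhds hmem]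
    exact Filter.EventuallyEq.deriv_eq (Filter.eventually_of_mem hmem hwv)
  have hdw0 : ∀ x, b < x → deriv w x = 0 := fun x hx => by
    have h : w =ᶠ[nhds x] fun _ => 0 := Filter.eventually_of_mem (Ioi_mem_nhds hx) hw0
    rw [h.deriv_eq, deriv_const]
  have h := hasDerivAt_integral_shift_mul_rpow (neg_lt_neg hν1) hw (sub_nonneg.2 hab.le) s
  rw [integral_shift_mul_rpow_eq hs.2.le (sub_le_sub_left hs.1.le b) hdw hdw0] at h
  refine h.congr_of_eventuallyEq (Filter.eventually_of_mem (Ioo_mem_nhds hs.1 hs.2) fun r hr => ?_)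
  exact (integral_shift_mul_rpow_eq hr.2.le (sub_le_sub_left hr.1.le b)
    (fun x hx => hwv x ⟨(hr.1.trans hx.1).le, hx.2.le⟩) hw0).symm
end

section
/- Let 0 < ν < 1, let a < b be reals, let ū : [a,b] → ℝ be continuous, and let v : [a,b] → ℝ be continuously differentiable with v(a) = v(b) = 0. Assume that for every x ∈ (a,b) the derivative d/dx ∫_a^x ū(s)·(x−s)^{−ν} ds exists and that the resulting function multiplied by v is integrable on (a,b), and likewise that for every s ∈ (a,b) the derivative d/ds ∫_s^b v(x)·(x−s)^{−ν} dx exists and the resulting function multiplied by ū is integrable on (a,b). Then ∫_a^b [(1/Γ(1−ν)) · d/dx ∫_a^x ū(s)·(x−s)^{−ν} ds] · v(x) dx = ∫_a^b ū(s) · [(−1/Γ(1−ν)) · d/ds ∫_s^b v(x)·(x−s)^{−ν} dx] ds; that is, ∫_a^b (D_{a+}^ν ū)(x)·v(x) dx = ∫_a^b ū(s)·(D_{b−}^ν v)(s) ds. -/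
open MeasureTheory Set Filter Topology

/-- Interchange of the order of integration for the kernel `(x - s) ^ (-ν)` on the triangle
`a < s ≤ x ≤ b`. -/
theorem integral_fractional_kernel_swap {ν a b : ℝ} (hν0 : 0 < ν) (hν1 : ν < 1) (hab : a ≤ b)
    {u p : ℝ → ℝ} (hu : ContinuousOn u (Icc a b)) (hp : ContinuousOn p (Icc a b)) :
    IntervalIntegrable (fun x => (∫ s in a..x, u s * (x - s) ^ (-ν)) * p x) volume a b ∧
    ∫ x in a..b, (∫ s in a..x, u s * (x - s) ^ (-ν)) * p x
      = ∫ s in a..b, u s * ∫ x in s..b, p x * (x - s) ^ (-ν) := by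
  set U : ℝ → ℝ := (Ioc a b).indicator u with hU
  set P : ℝ → ℝ := (Ioc a b).indicator p with hP
  set K : ℝ → ℝ := (Ioc 0 (b - a)).indicator (fun t => t ^ (-ν)) with hK
  have hUi : Integrable U :=
    (integrable_indicator_iff measurableSet_Ioc).2
      ((hu.integrableOn_Icc).mono_set Ioc_subset_Icc_self)
  have hPi : Integrable P :=
    (integrable_indicator_iff measurableSet_Ioc).2
      ((hp.integrableOn_Icc).mono_set Ioc_subset_Icc_self)
  have hKi : Integrable K := by
    refine (integrable_indicator_iff measurableSet_Ioc).2 ?_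
    exact (intervalIntegrable_iff_integrableOn_Ioc_of_le (by linarith)).1
      (intervalIntegral.intervalIntegrable_rpow' (by linarith))
  obtain ⟨C, hC⟩ := isCompact_Icc.exists_bound_of_continuousOn hp
  have hPb : ∀ x, ‖P x‖ ≤ max C 0 := fun x => by
    by_cases hx : x ∈ Ioc a b
    · simpa [hP, hx] using Or.inl (hC x (Ioc_subset_Icc_self hx))
    · simp [hP, hx]
  have hF : Integrable (Function.uncurry fun x s => P x * (U s * K (x - s)))
      (volume.prod volume) :=
    (hUi.convolution_integrand (ContinuousLinearMap.mul ℝ ℝ) hKi).bdd_mul (c := max C 0)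
      hPi.aestronglyMeasurable.comp_fst (ae_of_all _ fun z => hPb z.1)
  have inner_left : ∀ x, ∫ s, P x * (U s * K (x - s))
      = (Ioc a b).indicator (fun x => (∫ s in a..x, u s * (x - s) ^ (-ν)) * p x) x := by
    intro x
    by_cases hx : x ∈ Ioc a b
    · rw [integral_const_mul, indicator_of_mem hx, mul_comm, hP, indicator_of_mem hx,
        intervalIntegral.integral_of_le hx.1.le, ← integral_indicator measurableSet_Ioc]
      congr 1
      refine integral_congr_ae (ae_of_all _ fun s => ?_)
      by_cases hs : s ∈ Ioc a x
      · have h1 : s ∈ Ioc a b := ⟨hs.1, hs.2.trans hx.2⟩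
        rcases hs.2.eq_or_lt with rfl | hlt
        · rw [indicator_of_mem hs]
          simp [hK, Real.zero_rpow (neg_ne_zero.2 hν0.ne')]
        · have h2 : x - s ∈ Ioc 0 (b - a) := ⟨by linarith, by linarith [hs.1, hx.2]⟩
          simp only [hU, hK, indicator_of_mem h1, indicator_of_mem h2, indicator_of_mem hs]
      · simp only [indicator_of_notMem hs]
        by_cases h1 : s ∈ Ioc a b
        · have h2 : x - s ∉ Ioc 0 (b - a) := fun h => hs ⟨h1.1, by linarith [h.1]⟩
          simp only [hK, indicator_of_notMem h2, mul_zero]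
        · simp only [hU, indicator_of_notMem h1, zero_mul]
    · simp [hP, hx]
  have inner_right : ∀ s, ∫ x, P x * (U s * K (x - s))
      = (Ioc a b).indicator (fun s => u s * ∫ x in s..b, p x * (x - s) ^ (-ν)) s := by
    intro s
    by_cases hs : s ∈ Ioc a b
    · simp only [mul_left_comm _ (U s)]
      rw [integral_const_mul, indicator_of_mem hs, hU, indicator_of_mem hs,
        intervalIntegral.integral_of_le hs.2, ← integral_indicator measurableSet_Ioc]
      congr 1
      refine integral_congr_ae (ae_of_all _ fun x => ?_)
      by_cases hx : x ∈ Ioc s b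
      · have h1 : x ∈ Ioc a b := ⟨hs.1.trans hx.1, hx.2⟩
        have h2 : x - s ∈ Ioc 0 (b - a) := ⟨by linarith [hx.1], by linarith [hs.1, hx.2]⟩
        simp only [hP, hK, indicator_of_mem h1, indicator_of_mem h2, indicator_of_mem hx]
      · simp only [indicator_of_notMem hx]
        by_cases h1 : x ∈ Ioc a b
        · have h2 : x - s ∉ Ioc 0 (b - a) := fun h => hx ⟨by linarith [h.1], h1.2⟩
          simp only [hK, indicator_of_notMem h2, mul_zero]
        · simp only [hP, indicator_of_notMem h1, zero_mul]
    · simp [hU, hs]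
  constructor
  · rw [intervalIntegrable_iff_integrableOn_Ioc_of_le hab,
      ← integrable_indicator_iff measurableSet_Ioc]
    exact hF.integral_prod_left.congr (ae_of_all _ inner_left)
  · rw [intervalIntegral.integral_of_le hab, intervalIntegral.integral_of_le hab,
      ← integral_indicator measurableSet_Ioc, ← integral_indicator measurableSet_Ioc]
    simp only [← inner_left, ← inner_right]
    exact integral_integral_swap hF

/-- The translation `x = r + t`, written over a domain of integration independent of `r`. -/
theorem integral_fractional_kernel_eq_indicator {ν a b r : ℝ} (hr : r ∈ Icc a b) (φ : ℝ → ℝ) :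
    ∫ x in r..b, φ x * (x - r) ^ (-ν)
      = ∫ t in (0 : ℝ)..(b - a), (Iio (b - r)).indicator (fun t => φ (r + t)) t * t ^ (-ν) := by
  have h1 := intervalIntegral.integral_comp_add_left (a := 0) (b := b - r)
    (fun x => φ x * (x - r) ^ (-ν)) r
  simp only [add_zero, add_sub_cancel, add_sub_cancel_left] at h1
  rw [← h1, intervalIntegral.integral_of_le (by linarith [hr.2]),
    intervalIntegral.integral_of_le (by linarith [hr.1, hr.2])]
  have h2 : ∀ t, (Iio (b - r)).indicator (fun t => φ (r + t)) t * t ^ (-ν)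
      = (Iio (b - r)).indicator (fun t => φ (r + t) * t ^ (-ν)) t := fun t =>
    (indicator_mul_left _ (fun t => φ (r + t)) fun t => t ^ (-ν)).symm
  simp only [h2]
  rw [setIntegral_indicator measurableSet_Iio, integral_Ioc_eq_integral_Ioo]
  congr 2
  ext t
  simp only [mem_Ioo, mem_inter_iff, mem_Ioc, mem_Iio]
  exact ⟨fun h => ⟨⟨h.1, by linarith [hr.1, h.2]⟩, h.2⟩, fun h => ⟨h.1.1, h.2⟩⟩

/-- The right-sided fractional integral of a `C¹` function vanishing at the right endpoint is
differentiable, and its derivative is the fractional integral of the derivative. -/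
theorem hasDerivAt_integral_fractional_kernel {ν a b : ℝ} (hν1 : ν < 1) {v : ℝ → ℝ}
    (hv : ContDiffOn ℝ 1 v (Icc a b)) (hvb : v b = 0) {r : ℝ} (hr : r ∈ Ioo a b) :
    HasDerivAt (fun r => ∫ x in r..b, v x * (x - r) ^ (-ν))
      (∫ x in r..b, derivWithin v (Icc a b) x * (x - r) ^ (-ν)) r := by
  have hab : a < b := hr.1.trans hr.2
  have hp : ContinuousOn (derivWithin v (Icc a b)) (Icc a b) :=
    hv.continuousOn_derivWithin (uniqueDiffOn_Icc hab) le_rfl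
  set p := derivWithin v (Icc a b)
  obtain ⟨C, hC⟩ := isCompact_Icc.exists_bound_of_continuousOn hp
  have hC0 : 0 ≤ C := (norm_nonneg _).trans (hC a (left_mem_Icc.2 hab.le))
  have hlip : LipschitzOnWith C.toNNReal v (Icc a b) :=
    (convex_Icc a b).lipschitzOnWith_of_nnnorm_derivWithin_le
      (hv.differentiableOn one_ne_zero) fun x hx => by
        rw [← NNReal.coe_le_coe, Real.coe_toNNReal C hC0]
        exact hC x hx
  have hmem : ∀ {y t : ℝ}, y ∈ Ioo a b → t ∈ Ioc 0 (b - a) → min (y + t) b ∈ Icc a b :=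
    fun hy ht => ⟨le_min (by linarith [hy.1, ht.1]) hab.le, min_le_right _ _⟩
  have hshift : ∀ {φ : ℝ → ℝ}, ContinuousOn φ (Icc a b) → ∀ y ∈ Ioo a b,
      ContinuousOn (fun t => φ (min (y + t) b)) (Ioc 0 (b - a)) := fun hφ y hy =>
    hφ.comp (by fun_prop) fun t ht => hmem hy ht
  have hK : IntervalIntegrable (fun t : ℝ => t ^ (-ν)) volume 0 (b - a) :=
    intervalIntegral.intervalIntegrable_rpow' (by linarith)
  have hKm : AEStronglyMeasurable (fun t : ℝ => t ^ (-ν)) (volume.restrict (Ioc 0 (b - a))) :=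
    ((intervalIntegrable_iff_integrableOn_Ioc_of_le (by linarith)).1 hK).aestronglyMeasurable
  have hI : uIoc 0 (b - a) = Ioc 0 (b - a) := uIoc_of_le (by linarith)
  have hmeas : ∀ {φ : ℝ → ℝ}, ContinuousOn φ (Icc a b) → ∀ y ∈ Ioo a b,
      AEStronglyMeasurable (fun t => φ (min (y + t) b) * t ^ (-ν))
        (volume.restrict (Ioc 0 (b - a))) := fun hφ y hy =>
    ((hshift hφ y hy).aestronglyMeasurable measurableSet_Ioc).mul hKm
  have hV : (fun y => ∫ x in y..b, v x * (x - y) ^ (-ν)) =ᶠ[𝓝 r]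
      fun y => ∫ t in (0 : ℝ)..(b - a), v (min (y + t) b) * t ^ (-ν) := by
    filter_upwards [Ioo_mem_nhds hr.1 hr.2] with y hy
    rw [integral_fractional_kernel_eq_indicator (Ioo_subset_Icc_self hy)]
    congr 1
    ext t
    by_cases ht : y + t < b
    · rw [indicator_of_mem (show t ∈ Iio (b - y) by simp only [mem_Iio]; linarith),
        min_eq_left ht.le]
    · rw [indicator_of_notMem (show t ∉ Iio (b - y) by simp only [mem_Iio]; linarith),
        min_eq_right (not_lt.1 ht), hvb]
  refine HasDerivAt.congr_of_eventuallyEq ?_ hV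
  rw [integral_fractional_kernel_eq_indicator (Ioo_subset_Icc_self hr)]
  refine (intervalIntegral.hasDerivAt_integral_of_dominated_loc_of_lip
    (bound := fun t => C * t ^ (-ν)) (Ioo_mem_nhds hr.1 hr.2) ?_ ?_ ?_ ?_ (hK.const_mul C) ?_).2
  · rw [hI]
    filter_upwards [Ioo_mem_nhds hr.1 hr.2] with y hy using hmeas hv.continuousOn y hy
  · obtain ⟨D, hD⟩ := isCompact_Icc.exists_bound_of_continuousOn hv.continuousOn
    rw [intervalIntegrable_iff_integrableOn_Ioc_of_le (by linarith)] at hK ⊢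
    refine hK.bdd_mul (c := D) ((hshift hv.continuousOn r hr).aestronglyMeasurable
      measurableSet_Ioc) ?_
    filter_upwards [ae_restrict_mem measurableSet_Ioc] with t ht using hD _ (hmem hr ht)
  · rw [hI]
    refine ((hmeas hp r hr).indicator (measurableSet_Iio (a := b - r))).congr
      (ae_of_all _ fun t => ?_)
    by_cases ht : t ∈ Iio (b - r)
    · have : r + t ≤ b := by linarith [mem_Iio.1 ht]
      simp only [indicator_of_mem ht, min_eq_left this]
    · simp only [indicator_of_notMem ht, zero_mul]
  · refine ae_of_all _ fun t ht => ?_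
    rw [hI] at ht
    have hpos : 0 ≤ t ^ (-ν) := Real.rpow_nonneg ht.1.le _
    refine LipschitzOnWith.of_dist_le_mul fun x hx y hy => ?_
    have h1 := hlip.dist_le_mul _ (hmem hx ht) _ (hmem hy ht)
    have h2 : dist (min (x + t) b) (min (y + t) b) ≤ dist x y := by
      simp only [Real.dist_eq]
      refine (abs_min_sub_min_le_max _ _ _ _).trans ?_
      simp
    rw [Real.coe_toNNReal C hC0] at h1
    rw [Real.coe_nnabs, abs_of_nonneg (mul_nonneg hC0 hpos), Real.dist_eq, ← sub_mul, abs_mul,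
      abs_of_nonneg hpos, mul_right_comm, ← Real.dist_eq]
    exact mul_le_mul_of_nonneg_right (h1.trans (mul_le_mul_of_nonneg_left h2 hC0)) hpos
  · have hne : ∀ᵐ t : ℝ, t ≠ b - r := by simp [ae_iff]
    filter_upwards [hne] with t htne ht
    rw [hI] at ht
    refine HasDerivAt.mul_const ?_ _
    rcases lt_or_gt_of_ne htne with hlt | hgt
    · have hmem' : r + t ∈ Ioo a b := ⟨by linarith [hr.1, ht.1], by linarith⟩
      rw [indicator_of_mem (mem_Iio.2 hlt)]
      have hd : HasDerivAt v (p (r + t)) (r + t) :=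
        ((hv.differentiableOn one_ne_zero) _ (Ioo_subset_Icc_self hmem')).hasDerivWithinAt.hasDerivAt
          (Icc_mem_nhds hmem'.1 hmem'.2)
      refine (hd.comp_add_const r t).congr_of_eventuallyEq ?_
      filter_upwards [Iio_mem_nhds (show r < b - t by linarith)] with y hy
      rw [min_eq_left (by linarith [mem_Iio.1 hy])]
    · rw [indicator_of_notMem (by simpa using hgt.le)]
      refine (hasDerivAt_const r (v b)).congr_of_eventuallyEq ?_
      filter_upwards [Ioi_mem_nhds (show b - t < r by linarith)] with y hy
      rw [min_eq_right (by linarith [mem_Ioi.1 hy])]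

/-- The left-sided fractional integral of a bounded function is bounded. -/
theorem exists_bound_integral_fractional_kernel {ν a b : ℝ} (hν1 : ν < 1) (hab : a ≤ b)
    {u : ℝ → ℝ} (hu : ContinuousOn u (Icc a b)) :
    ∃ C, ∀ x ∈ Icc a b, |∫ s in a..x, u s * (x - s) ^ (-ν)| ≤ C := by
  obtain ⟨M, hM⟩ := isCompact_Icc.exists_bound_of_continuousOn hu
  have hM0 : 0 ≤ M := (norm_nonneg _).trans (hM a (left_mem_Icc.2 hab))
  refine ⟨M * ((b - a) ^ (-ν + 1) / (-ν + 1)), fun x hx => ?_⟩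
  have hK : IntervalIntegrable (fun s => M * (x - s) ^ (-ν)) volume a x := by
    have := (intervalIntegral.intervalIntegrable_rpow' (a := x - a) (b := 0) (r := -ν)
      (by linarith)).comp_sub_left x
    simpa using this.const_mul M
  have h1 : ‖∫ s in a..x, u s * (x - s) ^ (-ν)‖ ≤ ∫ s in a..x, M * (x - s) ^ (-ν) := by
    refine intervalIntegral.norm_integral_le_of_norm_le hx.1 (ae_of_all _ fun s hs => ?_) hK
    have hpos : 0 ≤ (x - s) ^ (-ν) := Real.rpow_nonneg (by linarith [hs.2]) _
    rw [norm_mul, Real.norm_of_nonneg hpos]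
    exact mul_le_mul_of_nonneg_right (hM s ⟨hs.1.le, hs.2.trans hx.2⟩) hpos
  refine h1.trans ?_
  rw [intervalIntegral.integral_const_mul,
    intervalIntegral.integral_comp_sub_left (fun t => t ^ (-ν)) x, sub_self,
    integral_rpow (Or.inl (by linarith)), Real.zero_rpow (by linarith), sub_zero]
  have hν : 0 < -ν + 1 := by linarith
  have hxa : 0 ≤ x - a := by linarith [hx.1]
  have hxb : x - a ≤ b - a := by linarith [hx.2]
  gcongr

/-- core transfer identity of Appendix D of the paper.
For `0 < ν < 1`, `ū` continuous on `[a,b]`, and `v` continuously differentiable with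
`v(a) = v(b) = 0`: with `g` the derivative defining `D_{a+}^ν ū = (1/Γ(1-ν)) g` and `h`
the derivative defining `D_{b-}^ν v = (-1/Γ(1-ν)) h` on `(a,b)`, and assuming
integrability of the two products, one has
`∫_a^b (D_{a+}^ν ū)(x) v(x) dx = ∫_a^b ū(s) (D_{b-}^ν v)(s) ds`. -/
theorem stmt12 (ν a b : ℝ) (hν0 : 0 < ν) (hν1 : ν < 1) (hab : a < b)
    (ubar v : ℝ → ℝ)
    (hubar : ContinuousOn ubar (Set.Icc a b))
    (hv : ContDiffOn ℝ 1 v (Set.Icc a b)) (hva : v a = 0) (hvb : v b = 0)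
    (g h : ℝ → ℝ)
    (hg : ∀ x ∈ Set.Ioo a b,
      HasDerivAt (fun y => ∫ s in a..y, ubar s * (y - s) ^ (-ν)) (g x) x)
    (hh : ∀ s ∈ Set.Ioo a b,
      HasDerivAt (fun r => ∫ x in r..b, v x * (x - r) ^ (-ν)) (h s) s)
    (hint1 : IntervalIntegrable (fun x => (1 / Real.Gamma (1 - ν)) * g x * v x)
      MeasureTheory.volume a b)
    (hint2 : IntervalIntegrable (fun s => ubar s * ((-1 / Real.Gamma (1 - ν)) * h s))
      MeasureTheory.volume a b) :
    ∫ x in a..b, (1 / Real.Gamma (1 - ν)) * g x * v x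
      = ∫ s in a..b, ubar s * ((-1 / Real.Gamma (1 - ν)) * h s) := by
  have hΓ : Real.Gamma (1 - ν) ≠ 0 := (Real.Gamma_pos_of_pos (by linarith)).ne'
  have hp : ContinuousOn (derivWithin v (Icc a b)) (Icc a b) :=
    hv.continuousOn_derivWithin (uniqueDiffOn_Icc hab) le_rfl
  obtain ⟨hUi, hswap⟩ := integral_fractional_kernel_swap hν0 hν1 hab.le hubar hp
  obtain ⟨C, hC⟩ := exists_bound_integral_fractional_kernel hν1 hab.le hubar
  have hgv : IntervalIntegrable (fun x => g x * v x) volume a b := by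
    refine (hint1.const_mul (Real.Gamma (1 - ν))).congr (fun x _ => ?_)
    field_simp
  have hda : Tendsto v (𝓝[>] a) (𝓝 0) := by
    have := (hv.continuousOn a (left_mem_Icc.2 hab.le)).mono_left
      (nhdsWithin_mono a Ioc_subset_Icc_self)
    rwa [nhdsWithin_Ioc_eq_nhdsGT hab, hva] at this
  have hdb : Tendsto v (𝓝[<] b) (𝓝 0) := by
    have := (hv.continuousOn b (right_mem_Icc.2 hab.le)).mono_left
      (nhdsWithin_mono b Ico_subset_Icc_self)
    rwa [nhdsWithin_Ico_eq_nhdsLT hab, hvb] at this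
  have hparts : ∫ x in a..b, (g x * v x
      + (∫ s in a..x, ubar s * (x - s) ^ (-ν)) * derivWithin v (Icc a b) x) = 0 - 0 := by
    refine intervalIntegral.integral_eq_sub_of_hasDerivAt_of_tendsto hab
      (f := fun x => (∫ s in a..x, ubar s * (x - s) ^ (-ν)) * v x) (fun x hx => ?_)
      (hgv.add hUi) ?_ ?_
    · exact (hg x hx).mul
        ((hv.differentiableOn one_ne_zero x (Ioo_subset_Icc_self hx)).hasDerivWithinAt.hasDerivAt
          (Icc_mem_nhds hx.1 hx.2))
    · refine bdd_le_mul_tendsto_zero' C ?_ hda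
      filter_upwards [Ioo_mem_nhdsGT hab] with x hx using hC x (Ioo_subset_Icc_self hx)
    · refine bdd_le_mul_tendsto_zero' C ?_ hdb
      filter_upwards [Ioo_mem_nhdsLT hab] with x hx using hC x (Ioo_subset_Icc_self hx)
  rw [intervalIntegral.integral_add hgv hUi, hswap] at hparts
  have hright : ∫ s in a..b, ubar s * h s
      = ∫ s in a..b, ubar s * ∫ x in s..b, derivWithin v (Icc a b) x * (x - s) ^ (-ν) := by
    rw [intervalIntegral.integral_of_le hab.le, intervalIntegral.integral_of_le hab.le,
      integral_Ioc_eq_integral_Ioo, integral_Ioc_eq_integral_Ioo]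
    refine setIntegral_congr_fun measurableSet_Ioo fun s hs => ?_
    simp only [(hh s hs).unique (hasDerivAt_integral_fractional_kernel hν1 hv hvb hs)]
  have e1 : ∀ x, 1 / Real.Gamma (1 - ν) * g x * v x = 1 / Real.Gamma (1 - ν) * (g x * v x) :=
    fun x => mul_assoc _ _ _
  have e2 : ∀ s, ubar s * (-1 / Real.Gamma (1 - ν) * h s)
      = -1 / Real.Gamma (1 - ν) * (ubar s * h s) := fun s => mul_left_comm _ _ _
  simp only [e1, e2, intervalIntegral.integral_const_mul]
  rw [hright, show ∫ x in a..b, g x * v x = -∫ s in a..b, ubar s * ∫ x in s..b,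
    derivWithin v (Icc a b) x * (x - s) ^ (-ν) by linarith]
  ring
end

section
/- Let d ≥ 1, N ≥ 1 and M_1,…,M_d ≥ 1 be integers, and γ ∈ ℝ. Let S_T, M_T be real N×N matrices and, for each j = 1,…,d, let S_j, M_j be real M_j×M_j matrices. Suppose: (i) there are vectors e_1^τ,…,e_N^τ forming a basis of ℝ^N and scalars λ_1^τ,…,λ_N^τ with M_T e_n^τ = λ_n^τ · S_T e_n^τ for all n, (e_{n'}^τ)ᵀ S_T e_n^τ = 0 whenever n' ≠ n, and (e_n^τ)ᵀ S_T e_n^τ ≠ 0 for all n; (ii) for each j there are vectors e_1^{(j)},…,e_{M_j}^{(j)} forming a basis of ℝ^{M_j} and scalars λ_1^{(j)},…,λ_{M_j}^{(j)} with S_j e_m^{(j)} = λ_m^{(j)} · M_j e_m^{(j)} for all m, (e_{m'}^{(j)})ᵀ M_j e_m^{(j)} = 0 whenever m' ≠ m, and (e_m^{(j)})ᵀ M_j e_m^{(j)} ≠ 0 for all m; (iii) for every multi-index (n, m_1,…,m_d), Λ_{n,m_1,…,m_d} := 1 + γ·λ_n^τ + λ_n^τ·∑_{j=1}^d λ_{m_j}^{(j)}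 ≠ 0. Let F ∈ ℝ^N ⊗ ℝ^{M_1} ⊗ ⋯ ⊗ ℝ^{M_d} be any tensor (equivalently a vector indexed by (k, r_1,…,r_d)). Define κ_{n,m_1,…,m_d} = ⟨ e_n^τ ⊗ e_{m_1}^{(1)} ⊗ ⋯ ⊗ e_{m_d}^{(d)}, F ⟩ / ( [(e_n^τ)ᵀ S_T e_n^τ] · ∏_{j=1}^d [(e_{m_j}^{(j)})ᵀ M_j e_{m_j}^{(j)}] · Λ_{n,m_1,…,m_d} ), where ⟨·,·⟩ is the standard entrywise inner product, and set U = ∑_{n,m_1,…,m_d} κ_{n,m_1,…,m_d} · e_n^τ ⊗ e_{m_1}^{(1)} ⊗ ⋯ ⊗ e_{m_d}^{(d)}. Then U solves the linear system [ S_T ⊗ M_1 ⊗ ⋯ ⊗ M_d + ∑_{j=1}^d M_T ⊗ M_1 ⊗ ⋯ ⊗ M_{j−1} ⊗ S_j ⊗ M_{j+1} ⊗ ⋯ ⊗ M_d + γ · M_T ⊗ M_1 ⊗ ⋯ ⊗ M_d ] U = F, where ⊗ between matrices denotes the Kronecker product. -/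
open Matrix

/-- If `v` is `A`-orthogonal with nonvanishing `A`-norms, then the associated
spectral projections resolve the identity. -/
lemma sum_mulVec_mul_div_eq_one {K ι : Type*} [Field K] [Fintype ι] [DecidableEq ι]
    (A : Matrix ι ι K) (v : ι → ι → K)
    (horth : ∀ n n', n' ≠ n → v n' ⬝ᵥ A.mulVec (v n) = 0)
    (hnz : ∀ n, v n ⬝ᵥ A.mulVec (v n) ≠ 0) (r q : ι) :
    ∑ n, A.mulVec (v n) r * v n q / (v n ⬝ᵥ A.mulVec (v n)) = (1 : Matrix ι ι K) r q := by
  let E : Matrix ι ι K := Matrix.of v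
  let X : Matrix ι ι K :=
    Matrix.of fun r n => A.mulVec (v n) r / (v n ⬝ᵥ A.mulVec (v n))
  have hEX : E * X = 1 := by
    ext a b
    have h : (E * X) a b = (v a ⬝ᵥ A.mulVec (v b)) / (v b ⬝ᵥ A.mulVec (v b)) := by
      simp only [E, X, Matrix.mul_apply, Matrix.of_apply, mul_div_assoc', ← Finset.sum_div]
      rfl
    rw [h]
    by_cases hab : a = b
    · subst hab
      rw [div_self (hnz a), Matrix.one_apply_eq]
    · rw [horth b a hab, zero_div, Matrix.one_apply_ne hab]
  rw [← mul_eq_one_comm.mp hEX, Matrix.mul_apply]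
  refine Finset.sum_congr rfl fun n _ => ?_
  simp only [E, X, Matrix.of_apply]
  ring

/-- A double sum over a product index set of a rank-one summand factors. -/
lemma sum_sum_mul_prod {K ι κ : Type*} {β : κ → Type*} [CommSemiring K] [Fintype ι] [Fintype κ]
    [DecidableEq κ] [∀ i, Fintype (β i)] (f : ι → K) (g : (i : κ) → β i → K) :
    ∑ n, ∑ m : (i : κ) → β i, f n * ∏ i, g i (m i) = (∑ n, f n) * ∏ i, ∑ b, g i b := by
  rw [Finset.prod_univ_sum, Fintype.piFinset_univ, Finset.sum_mul_sum]

/-- The Kronecker product `A ⊗ ⨂ i, B i` applied to a combination of rank-one tensors. -/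
lemma kronecker_apply_sum_rank_one {K ι κ σ τ : Type*} {β : κ → Type*} [CommSemiring K]
    [Fintype ι] [Fintype κ] [DecidableEq κ] [∀ i, Fintype (β i)] [Fintype σ] [Fintype τ]
    (A : Matrix ι ι K) (B : (i : κ) → Matrix (β i) (β i) K)
    (c : σ → τ → K) (v : σ → ι → K) (w : τ → (i : κ) → β i → K)
    (k : ι) (r : (i : κ) → β i) :
    ∑ n, ∑ m : (i : κ) → β i, A k n * (∏ i, B i (r i) (m i)) *
        (∑ s, ∑ t, c s t * (v s n * ∏ i, w t i (m i))) =
      ∑ s, ∑ t, c s t * (A.mulVec (v s) k * ∏ i, (B i).mulVec (w t i) (r i)) := by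
  have key : ∀ s t, A.mulVec (v s) k * ∏ i, (B i).mulVec (w t i) (r i) =
      ∑ p : ι × ((i : κ) → β i),
        A k p.1 * v s p.1 * ∏ i, B i (r i) (p.2 i) * w t i (p.2 i) := by
    intro s t
    rw [Fintype.sum_prod_type]
    exact (sum_sum_mul_prod (fun n => A k n * v s n)
      (fun i b => B i (r i) b * w t i b)).symm
  simp only [key]
  rw [← Fintype.sum_prod_type' (f := fun n (m : (i : κ) → β i) =>
    A k n * (∏ i, B i (r i) (m i)) * (∑ s, ∑ t, c s t * (v s n * ∏ i, w t i (m i))))]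
  simp only [Finset.mul_sum]
  rw [Finset.sum_comm]
  refine Finset.sum_congr rfl fun s _ => ?_
  rw [Finset.sum_comm]
  refine Finset.sum_congr rfl fun t _ => Finset.sum_congr rfl fun p _ => ?_
  rw [Finset.prod_mul_distrib]
  ring

/-- Theorem 5.1 of the paper: unified fast FPDE solver.
Tensors are modeled as real-valued functions on the product index set
`Fin N × ((j : Fin d) → Fin (M j))`, and Kronecker products of matrices act entrywise:
`(A ⊗ B_1 ⊗ ⋯ ⊗ B_d) U (k, r) = ∑_{n,m} A k n (∏_j B_j (r j) (m j)) U (n, m)`.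
Given generalized eigen-solutions `(eT n, lamT n)` of the temporal mass matrix `MT`
with respect to the stiffness matrix `ST` (a basis of `ℝ^N`, `ST`-orthogonal, with
nonvanishing `ST`-norms), generalized eigen-solutions `(e j m, lam j m)` of each
spatial stiffness matrix `S j` with respect to its mass matrix `Mm j` (bases,
`Mm j`-orthogonal, nonvanishing `Mm j`-norms), and assuming all
`Λ_{n,m} = 1 + γ lamT n + lamT n ∑_j lam j (m j)` are nonzero, the explicitly defined
tensor `U` solves the Lyapunov system
`[ST ⊗ M_1 ⊗ ⋯ ⊗ M_d + ∑_j MT ⊗ M_1 ⊗ ⋯ ⊗ S_j ⊗ ⋯ ⊗ M_d + γ MT ⊗ M_1 ⊗ ⋯ ⊗ M_d] U = F`. -/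
theorem stmt13 (d N : ℕ) (hd : 1 ≤ d) (hN : 1 ≤ N)
    (M : Fin d → ℕ) (hM : ∀ j, 1 ≤ M j)
    (γ : ℝ)
    (ST MT : Matrix (Fin N) (Fin N) ℝ)
    (S Mm : (j : Fin d) → Matrix (Fin (M j)) (Fin (M j)) ℝ)
    (eT : Fin N → (Fin N → ℝ)) (lamT : Fin N → ℝ)
    (hTindep : LinearIndependent ℝ eT)
    (hTspan : Submodule.span ℝ (Set.range eT) = ⊤)
    (hTeig : ∀ n, MT.mulVec (eT n) = lamT n • ST.mulVec (eT n))
    (hTorth : ∀ n n', n' ≠ n → eT n' ⬝ᵥ ST.mulVec (eT n) = 0)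
    (hTnz : ∀ n, eT n ⬝ᵥ ST.mulVec (eT n) ≠ 0)
    (e : (j : Fin d) → Fin (M j) → (Fin (M j) → ℝ))
    (lam : (j : Fin d) → Fin (M j) → ℝ)
    (hindep : ∀ j, LinearIndependent ℝ (e j))
    (hspan : ∀ j, Submodule.span ℝ (Set.range (e j)) = ⊤)
    (heig : ∀ j m, (S j).mulVec (e j m) = lam j m • (Mm j).mulVec (e j m))
    (horth : ∀ j m m', m' ≠ m → e j m' ⬝ᵥ (Mm j).mulVec (e j m) = 0)
    (hnz : ∀ j m, e j m ⬝ᵥ (Mm j).mulVec (e j m) ≠ 0)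
    (hΛ : ∀ (n : Fin N) (m : (j : Fin d) → Fin (M j)),
      1 + γ * lamT n + lamT n * ∑ j, lam j (m j) ≠ 0)
    (F U : Fin N × ((j : Fin d) → Fin (M j)) → ℝ)
    (hU : U = fun p =>
      ∑ n : Fin N, ∑ m : (j : Fin d) → Fin (M j),
        ((∑ q : Fin N × ((j : Fin d) → Fin (M j)),
            (eT n q.1 * ∏ j, e j (m j) (q.2 j)) * F q) /
          ((eT n ⬝ᵥ ST.mulVec (eT n)) *
            (∏ j, e j (m j) ⬝ᵥ (Mm j).mulVec (e j (m j))) *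
            (1 + γ * lamT n + lamT n * ∑ j, lam j (m j)))) *
        (eT n p.1 * ∏ j, e j (m j) (p.2 j))) :
    ∀ p : Fin N × ((j : Fin d) → Fin (M j)),
      (∑ n : Fin N, ∑ m : (j : Fin d) → Fin (M j),
          ST p.1 n * (∏ i, Mm i (p.2 i) (m i)) * U (n, m))
        + (∑ j : Fin d, ∑ n : Fin N, ∑ m : (j' : Fin d) → Fin (M j'),
            MT p.1 n * (∏ i, (if i = j then S i else Mm i) (p.2 i) (m i)) * U (n, m))
        + γ * (∑ n : Fin N, ∑ m : (j : Fin d) → Fin (M j),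
            MT p.1 n * (∏ i, Mm i (p.2 i) (m i)) * U (n, m))
      = F p := by
  rintro ⟨k, r⟩
  subst hU
  let w : ((j : Fin d) → Fin (M j)) → (j : Fin d) → Fin (M j) → ℝ := fun m j => e j (m j)
  refine (congrArg₂ (· + ·) (congrArg₂ (· + ·)
    (kronecker_apply_sum_rank_one ST Mm _ eT w k r)
    (Finset.sum_congr rfl fun j _ =>
      kronecker_apply_sum_rank_one MT (fun i => if i = j then S i else Mm i) _ eT w k r))
    (congrArg (γ * ·) (kronecker_apply_sum_rank_one MT Mm _ eT w k r))).trans ?_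
  have hS : ∀ (m : (j : Fin d) → Fin (M j)) (j : Fin d),
      ∏ i, (if i = j then S i else Mm i).mulVec (e i (m i)) (r i) =
        lam j (m j) * ∏ i, (Mm i).mulVec (e i (m i)) (r i) := by
    intro m j
    rw [← Finset.mul_prod_erase _ _ (Finset.mem_univ j),
      ← Finset.mul_prod_erase _ (fun i => (Mm i).mulVec (e i (m i)) (r i)) (Finset.mem_univ j),
      if_pos rfl, heig, Pi.smul_apply, smul_eq_mul, mul_assoc]
    congr 2
    refine Finset.prod_congr rfl fun i hi => ?_
    rw [if_neg (Finset.ne_of_mem_erase hi)]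
  simp only [w, hS, hTeig, Pi.smul_apply, smul_eq_mul]
  rw [Finset.sum_comm (s := (Finset.univ : Finset (Fin d))), Finset.mul_sum, ← Finset.sum_add_distrib, ← Finset.sum_add_distrib]
  have hone : ∀ q : Fin N × ((j : Fin d) → Fin (M j)),
      ∑ n, ∑ m : (j : Fin d) → Fin (M j),
        (ST.mulVec (eT n) k * eT n q.1 / (eT n ⬝ᵥ ST.mulVec (eT n))) *
          ∏ j, ((Mm j).mulVec (e j (m j)) (r j) * e j (m j) (q.2 j) /
            (e j (m j) ⬝ᵥ (Mm j).mulVec (e j (m j)))) = if (k, r) = q then 1 else 0 := by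
    intro q
    rw [sum_sum_mul_prod (fun n => ST.mulVec (eT n) k * eT n q.1 / (eT n ⬝ᵥ ST.mulVec (eT n)))
      (fun j b => (Mm j).mulVec (e j b) (r j) * e j b (q.2 j) /
        (e j b ⬝ᵥ (Mm j).mulVec (e j b))), sum_mulVec_mul_div_eq_one ST eT hTorth hTnz]
    simp only [fun j => sum_mulVec_mul_div_eq_one (Mm j) (e j) (horth j) (hnz j),
      Matrix.one_apply, Finset.prod_ite_zero, Finset.prod_const_one, Finset.mem_univ,
      true_imp_iff, ite_zero_mul_ite_zero, mul_one, Prod.ext_iff, funext_iff]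
  calc _ = ∑ n, ∑ m : (j : Fin d) → Fin (M j), ∑ q : Fin N × ((j : Fin d) → Fin (M j)),
        ((ST.mulVec (eT n) k * eT n q.1 / (eT n ⬝ᵥ ST.mulVec (eT n))) *
          ∏ j, ((Mm j).mulVec (e j (m j)) (r j) * e j (m j) (q.2 j) /
            (e j (m j) ⬝ᵥ (Mm j).mulVec (e j (m j))))) * F q := by
        refine Finset.sum_congr rfl fun n _ => ?_
        rw [Finset.sum_comm (s := (Finset.univ : Finset (Fin d))), Finset.mul_sum, ← Finset.sum_add_distrib, ← Finset.sum_add_distrib]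
        refine Finset.sum_congr rfl fun m _ => ?_
        have hm := hΛ n m
        have hP : (∏ j, e j (m j) ⬝ᵥ (Mm j).mulVec (e j (m j))) ≠ 0 :=
          Finset.prod_ne_zero_iff.mpr fun j _ => hnz j (m j)
        have hn := hTnz n
        have hR : ∑ q : Fin N × ((j : Fin d) → Fin (M j)),
            ((ST.mulVec (eT n) k * eT n q.1 / (eT n ⬝ᵥ ST.mulVec (eT n))) *
              ∏ j, ((Mm j).mulVec (e j (m j)) (r j) * e j (m j) (q.2 j) /
                (e j (m j) ⬝ᵥ (Mm j).mulVec (e j (m j))))) * F q =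
            ST.mulVec (eT n) k * (∏ j, (Mm j).mulVec (e j (m j)) (r j)) /
              ((eT n ⬝ᵥ ST.mulVec (eT n)) * ∏ j, e j (m j) ⬝ᵥ (Mm j).mulVec (e j (m j))) *
              ∑ q : Fin N × ((j : Fin d) → Fin (M j)),
                (eT n q.1 * ∏ j, e j (m j) (q.2 j)) * F q := by
          rw [Finset.mul_sum]
          refine Finset.sum_congr rfl fun q _ => ?_
          rw [Finset.prod_div_distrib, Finset.prod_mul_distrib]
          ring
        rw [hR]
        generalize (∑ q : Fin N × ((j : Fin d) → Fin (M j)),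
          (eT n q.1 * ∏ j, e j (m j) (q.2 j)) * F q) = G
        generalize (∏ j, (Mm j).mulVec (e j (m j)) (r j)) = Q
        generalize (∏ j, e j (m j) ⬝ᵥ (Mm j).mulVec (e j (m j))) = P at hP ⊢
        generalize eT n ⬝ᵥ ST.mulVec (eT n) = D at hn ⊢
        generalize ST.mulVec (eT n) k = x
        have hsum : ∀ c : ℝ, ∑ j, c * (lamT n * x * (lam j (m j) * Q)) =
            c * (lamT n * x * ((∑ j, lam j (m j)) * Q)) := by
          intro c
          rw [Finset.sum_mul, Finset.mul_sum, Finset.mul_sum]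
        rw [hsum]
        generalize ∑ j, lam j (m j) = s at hm ⊢
        field_simp
        ring
    _ = ∑ q : Fin N × ((j : Fin d) → Fin (M j)), (if (k, r) = q then 1 else 0) * F q := by
        simp only [← hone, Finset.sum_mul]
        rw [Finset.sum_comm (s := (Finset.univ : Finset (Fin N × ((j : Fin d) → Fin (M j)))))]
        exact Finset.sum_congr rfl fun n _ => Finset.sum_comm
    _ = F (k, r) := by simp
end

section
/- Let 0 < α₀ < 1 and T > 0. Let u, f : (0,1) × [0,T] → ℝ satisfy: u(α, 0) = 0 for every α ∈ (0,1); u is jointly continuous with jointly continuous partial derivative ∂u/∂α; for each fixed t ∈ (0,T], the map α ↦ f(α,t) is differentiable at α₀; and for every α ∈ (0,1) and t ∈ (0,T] the fractional initial-value problem holds: (1/Γ(1−α)) · d/dt ∫_0^t (t−s)^{−α} u(α,s) ds = f(α,t). Set I(α,y) = ∫_0^y (y−s)^{−α} u(α,s) ds, fix t ∈ (0,T], and assume I has partial derivatives ∂I/∂t and ∂I/∂α in a neighborhood of (α₀,t) with mixed second partial derivatives existing and commuting at (α₀,t), and that the maps y ↦ ∫_0^y (y−s)^{−α₀}·(∂u/∂α)(α₀,s)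 ds and y ↦ ∫_0^y log(y−s)·(y−s)^{−α₀}·u(α₀,s) ds are differentiable at y = t. Then the sensitivity S(s) := (∂u/∂α)(α₀,s) satisfies S(0) = 0 and (1/Γ(1−α₀)) · d/dt ∫_0^t (t−s)^{−α₀} S(s) ds = (∂f/∂α)(α₀,t) − A₁(α₀)·f(α₀,t) + (1/Γ(1−α₀)) · d/dt ∫_0^t log(t−s)·(t−s)^{−α₀}·u(α₀,s) ds, where A₁(α) := Γ(1−α)·(d/dα)(1/Γ(1−α)). -/
open MeasureTheory Set Filter Topology
open scoped Interval

/-- A power of `x > 0` with exponent between `-c` and `1` is dominated by `x ^ (-c) + x`. -/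
theorem rpow_neg_le_rpow_neg_add_self {x p c : ℝ} (hx : 0 < x) (hp : -1 ≤ p) (hpc : p ≤ c) :
    x ^ (-p) ≤ x ^ (-c) + x := by
  rcases le_total x 1 with h | h
  · have := Real.rpow_le_rpow_of_exponent_ge hx h (neg_le_neg hpc)
    linarith
  · have h1 := Real.rpow_le_rpow_of_exponent_le h (show -p ≤ 1 by linarith)
    rw [Real.rpow_one] at h1
    have := Real.rpow_nonneg hx.le (-c)
    linarith

theorem abs_log_le_rpow_add_rpow_neg_div {x δ : ℝ} (hx : 0 < x) (hδ : 0 < δ) :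
    |Real.log x| ≤ (x ^ δ + x ^ (-δ)) / δ := by
  have h1 := Real.log_le_rpow_div hx.le hδ
  have h2 := Real.log_le_rpow_div (inv_pos.2 hx).le hδ
  rw [Real.log_inv, Real.inv_rpow hx.le, ← Real.rpow_neg hx.le] at h2
  have h3 : 0 ≤ x ^ δ / δ := by positivity
  have h4 : 0 ≤ x ^ (-δ) / δ := by positivity
  rw [add_div, abs_le]
  constructor <;> linarith

theorem abs_log_mul_rpow_neg_le {x δ α c : ℝ} (hx : 0 < x) (hδ : 0 < δ) (hδ1 : δ ≤ 1)
    (hα : 0 ≤ α) (hc : α + δ ≤ c) :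
    |Real.log x| * x ^ (-α) ≤ 2 / δ * (x ^ (-c) + x) := by
  calc |Real.log x| * x ^ (-α) ≤ (x ^ δ + x ^ (-δ)) / δ * x ^ (-α) := by
        gcongr
        exact abs_log_le_rpow_add_rpow_neg_div hx hδ
    _ = (x ^ (-(α - δ)) + x ^ (-(α + δ))) / δ := by
        rw [show -(α - δ) = δ + -α by ring, show -(α + δ) = -δ + -α by ring,
          Real.rpow_add hx, Real.rpow_add hx]
        ring
    _ ≤ ((x ^ (-c) + x) + (x ^ (-c) + x)) / δ := by
        gcongr
        · exact rpow_neg_le_rpow_neg_add_self hx (by linarith) (by linarith)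
        · exact rpow_neg_le_rpow_neg_add_self hx (by linarith) hc
    _ = 2 / δ * (x ^ (-c) + x) := by ring

theorem intervalIntegrable_sub_rpow_neg_add {c : ℝ} (hc : c < 1) (y : ℝ) :
    IntervalIntegrable (fun s => (y - s) ^ (-c) + (y - s)) volume 0 y := by
  have h : IntervalIntegrable (fun x : ℝ => x ^ (-c) + x) volume 0 y :=
    (intervalIntegral.intervalIntegrable_rpow' (by linarith)).add
      intervalIntegral.intervalIntegrable_id
  simpa using (h.comp_sub_left y).symm

/-- Differentiation of the weakly singular integral `∫ₛ (y - s) ^ (-α) u(α, s)` with respect to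
the order `α`, together with integrability of the two terms of the derivative. -/
theorem hasDerivAt_order_integral {T α₀ y : ℝ} (hα₀ : α₀ ∈ Ioo (0 : ℝ) 1) {u uα : ℝ → ℝ → ℝ}
    (hcont : ContinuousOn (fun p : ℝ × ℝ => u p.1 p.2) (Ioo 0 1 ×ˢ Icc 0 T))
    (huα : ∀ α ∈ Ioo (0 : ℝ) 1, ∀ s ∈ Icc (0 : ℝ) T, HasDerivAt (fun τ => u τ s) (uα α s) α)
    (hcontα : ContinuousOn (fun p : ℝ × ℝ => uα p.1 p.2) (Ioo 0 1 ×ˢ Icc 0 T))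
    (hy : y ∈ Ioc (0 : ℝ) T) :
    HasDerivAt (fun τ => ∫ s in (0 : ℝ)..y, (y - s) ^ (-τ) * u τ s)
      ((∫ s in (0 : ℝ)..y, (y - s) ^ (-α₀) * uα α₀ s)
        - ∫ s in (0 : ℝ)..y, Real.log (y - s) * (y - s) ^ (-α₀) * u α₀ s) α₀ := by
  obtain ⟨h0, h1⟩ := hα₀
  obtain ⟨hy0, hyT⟩ := hy
  obtain ⟨a, ha0, ha⟩ := exists_between h0
  obtain ⟨b, hb, hb1⟩ := exists_between h1
  have hsub : Icc a b ×ˢ Icc 0 T ⊆ Ioo (0 : ℝ) 1 ×ˢ Icc 0 T :=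
    prod_mono (fun x hx => ⟨ha0.trans_le hx.1, hx.2.trans_lt hb1⟩) subset_rfl
  have hK : IsCompact (Icc a b ×ˢ Icc (0 : ℝ) T) := isCompact_Icc.prod isCompact_Icc
  obtain ⟨C₁, hC₁⟩ := hK.exists_bound_of_continuousOn (hcont.mono hsub)
  obtain ⟨C₂, hC₂⟩ := hK.exists_bound_of_continuousOn (hcontα.mono hsub)
  have hΙ : Ι 0 y ⊆ Icc 0 T := by
    rw [uIoc_of_le hy0.le]
    exact fun s hs => ⟨hs.1.le, hs.2.trans hyT⟩
  have hmeas : ∀ {v : ℝ → ℝ → ℝ},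
      ContinuousOn (fun p : ℝ × ℝ => v p.1 p.2) (Ioo 0 1 ×ˢ Icc 0 T) → ∀ α ∈ Ioo (0 : ℝ) 1,
      AEStronglyMeasurable (v α) (volume.restrict (Ι 0 y)) := by
    intro v hv α hα
    have h : ContinuousOn (v α) (Icc 0 T) :=
      hv.comp (f := fun s => (α, s)) (by fun_prop) fun s hs => ⟨hα, hs⟩
    exact (h.mono hΙ).aestronglyMeasurable measurableSet_uIoc
  have hmeas_pow : ∀ α : ℝ,
      AEStronglyMeasurable (fun s => (y - s) ^ (-α)) (volume.restrict (Ι 0 y)) :=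
    fun α => Measurable.aestronglyMeasurable (by fun_prop)
  have hmeas_log : AEStronglyMeasurable (fun s => Real.log (y - s)) (volume.restrict (Ι 0 y)) :=
    Measurable.aestronglyMeasurable (by fun_prop)
  have hC₁0 : 0 ≤ C₁ :=
    (norm_nonneg _).trans (hC₁ (α₀, 0) ⟨⟨ha.le, hb.le⟩, le_rfl, hy0.le.trans hyT⟩)
  have hC₂0 : 0 ≤ C₂ :=
    (norm_nonneg _).trans (hC₂ (α₀, 0) ⟨⟨ha.le, hb.le⟩, le_rfl, hy0.le.trans hyT⟩)
  set δ := (1 - b) / 2 with hδ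
  have hδ0 : 0 < δ := by linarith
  set w : ℝ → ℝ := fun s => (y - s) ^ (-(b + δ)) + (y - s)
  have hw_int : IntervalIntegrable w volume 0 y :=
    intervalIntegrable_sub_rpow_neg_add (by linarith) y
  have hpos : ∀ᵐ s, s ∈ Ι 0 y → 0 < y - s := by
    filter_upwards [Measure.ae_ne volume y] with s hs hsI
    rw [uIoc_of_le hy0.le] at hsI
    exact sub_pos.2 (lt_of_le_of_ne hsI.2 hs)
  have hbound_pow : ∀ {v : ℝ → ℝ → ℝ} {C : ℝ},
      (∀ p ∈ Icc a b ×ˢ Icc (0 : ℝ) T, ‖v p.1 p.2‖ ≤ C) → ∀ α ∈ Icc a b, ∀ s ∈ Ι 0 y,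
      0 < y - s → ‖(y - s) ^ (-α) * v α s‖ ≤ C * w s := by
    intro v C hv α hα s hs hys
    rw [norm_mul, Real.norm_of_nonneg (Real.rpow_nonneg hys.le _), mul_comm]
    have := rpow_neg_le_rpow_neg_add_self (c := b + δ) hys (by linarith [hα.1])
      (by linarith [hα.2] : α ≤ b + δ)
    exact mul_le_mul (hv (α, s) ⟨hα, hΙ hs⟩) this (by positivity)
      ((norm_nonneg _).trans (hv (α, s) ⟨hα, hΙ hs⟩))
  have hbound_log : ∀ α ∈ Icc a b, ∀ s ∈ Ι 0 y, 0 < y - s →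
      ‖Real.log (y - s) * (y - s) ^ (-α) * u α s‖ ≤ C₁ * (2 / δ) * w s := by
    intro α hα s hs hys
    rw [norm_mul, norm_mul, Real.norm_of_nonneg (Real.rpow_nonneg hys.le _), mul_comm,
      Real.norm_eq_abs (Real.log _), mul_assoc]
    have := abs_log_mul_rpow_neg_le (c := b + δ) hys hδ0 (by linarith)
      (by linarith [hα.1] : 0 ≤ α) (by linarith [hα.2])
    exact mul_le_mul (hC₁ (α, s) ⟨hα, hΙ hs⟩) this (by positivity) hC₁0
  have hα₀mem : α₀ ∈ Icc a b := ⟨ha.le, hb.le⟩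
  have hint : ∀ {g : ℝ → ℝ} {C : ℝ}, AEStronglyMeasurable g (volume.restrict (Ι 0 y)) →
      (∀ s ∈ Ι 0 y, 0 < y - s → ‖g s‖ ≤ C * w s) → IntervalIntegrable g volume 0 y := by
    intro g C hg hgC
    refine (hw_int.const_mul C).mono_fun' hg ?_
    rw [EventuallyLE, ae_restrict_iff' measurableSet_uIoc]
    filter_upwards [hpos] with s hs hsI using hgC s hsI (hs hsI)
  have hint_pow := hint ((hmeas_pow α₀).mul (hmeas hcontα α₀ ⟨h0, h1⟩)) (hbound_pow hC₂ α₀ hα₀mem)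
  have hint_log := hint ((hmeas_log.mul (hmeas_pow α₀)).mul (hmeas hcont α₀ ⟨h0, h1⟩))
    (hbound_log α₀ hα₀mem)
  have key := intervalIntegral.hasDerivAt_integral_of_dominated_loc_of_deriv_le
    (μ := volume) (a := 0) (b := y) (x₀ := α₀) (s := Icc a b)
    (F := fun τ s => (y - s) ^ (-τ) * u τ s)
    (F' := fun τ s => (y - s) ^ (-τ) * uα τ s - Real.log (y - s) * (y - s) ^ (-τ) * u τ s)
    (bound := fun s => C₂ * w s + C₁ * (2 / δ) * w s)
    (Icc_mem_nhds ha hb)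
    (by
      filter_upwards [Ioo_mem_nhds h0 h1] with τ hτ using (hmeas_pow τ).mul (hmeas hcont τ hτ))
    (hint ((hmeas_pow α₀).mul (hmeas hcont α₀ ⟨h0, h1⟩)) (hbound_pow hC₁ α₀ hα₀mem))
    (((hmeas_pow α₀).mul (hmeas hcontα α₀ ⟨h0, h1⟩)).sub
      ((hmeas_log.mul (hmeas_pow α₀)).mul (hmeas hcont α₀ ⟨h0, h1⟩)))
    (by
      filter_upwards [hpos] with s hs hsI τ hτ
      exact (norm_sub_le _ _).trans (add_le_add (hbound_pow hC₂ τ hτ s hsI (hs hsI))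
        (hbound_log τ hτ s hsI (hs hsI))))
    ((hw_int.const_mul C₂).add (hw_int.const_mul _))
    (by
      filter_upwards [hpos] with s hs hsI τ hτ
      have hτ' : τ ∈ Ioo (0 : ℝ) 1 := ⟨ha0.trans_le hτ.1, hτ.2.trans_lt hb1⟩
      have := ((hasDerivAt_id τ).neg.const_rpow (hs hsI)).mul (huα τ hτ' s (hΙ hsI))
      refine this.congr_deriv ?_
      simp only [id, Pi.neg_apply]
      ring)
  exact key.2.congr_deriv (intervalIntegral.integral_sub hint_pow hint_log)


/-- adjoint fractional sensitivity equation for the FIVP,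
Section 4.1 of the paper.
For the fractional initial value problem `D_{0+}^α u(·;α) = f(·;α)`, `α ∈ (0,1)`,
with `u(α,0) = 0`, `u` and `∂u/∂α =: uα` jointly continuous, `α ↦ f(α,t)`
differentiable at `α₀` for each `t ∈ (0,T]` (derivative `fα t`), the FIVP encoded as
`d/dt I(α,t) = Γ(1-α) f(α,t)` where `I(α,y) = ∫_0^y (y-s)^{-α} u(α,s) ds`, partial
derivatives `It = ∂I/∂t`, `Iα = ∂I/∂α` on a neighborhood `V` of `(α₀,t)` with
commuting mixed second partials (common value `Mmix`), and `D1`, `D2` the derivatives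
at `t` of `y ↦ ∫_0^y (y-s)^{-α₀} uα(α₀,s) ds` and
`y ↦ ∫_0^y log(y-s)(y-s)^{-α₀} u(α₀,s) ds`, the sensitivity `S = uα(α₀,·)` satisfies
`S(0) = 0` and `(1/Γ(1-α₀)) D1 = fα(t) - A₁(α₀) f(α₀,t) + (1/Γ(1-α₀)) D2`, where
`A₁(α) = Γ(1-α) (d/dα)(1/Γ(1-α))`. -/
theorem stmt14 (T : ℝ) (hT : 0 < T) (α₀ : ℝ) (hα₀ : α₀ ∈ Set.Ioo (0:ℝ) 1)
    (u uα f : ℝ → ℝ → ℝ)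
    (hu0 : ∀ α ∈ Set.Ioo (0:ℝ) 1, u α 0 = 0)
    (hcont : ContinuousOn (fun p : ℝ × ℝ => u p.1 p.2) (Set.Ioo 0 1 ×ˢ Set.Icc 0 T))
    (huα : ∀ α ∈ Set.Ioo (0:ℝ) 1, ∀ s ∈ Set.Icc (0:ℝ) T,
      HasDerivAt (fun τ => u τ s) (uα α s) α)
    (hcontα : ContinuousOn (fun p : ℝ × ℝ => uα p.1 p.2) (Set.Ioo 0 1 ×ˢ Set.Icc 0 T))
    (fα : ℝ → ℝ)
    (hfα : ∀ t ∈ Set.Ioc (0:ℝ) T, HasDerivAt (fun τ => f τ t) (fα t) α₀)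
    (hFIVP : ∀ α ∈ Set.Ioo (0:ℝ) 1, ∀ r ∈ Set.Ioc (0:ℝ) T,
      HasDerivAt (fun y => ∫ s in (0:ℝ)..y, (y - s) ^ (-α) * u α s)
        (Real.Gamma (1 - α) * f α r) r)
    (t : ℝ) (ht : t ∈ Set.Ioc (0:ℝ) T)
    (It Iα : ℝ → ℝ → ℝ)
    (V : Set (ℝ × ℝ)) (hV : V ∈ nhds (α₀, t))
    (hIt : ∀ p ∈ V,
      HasDerivAt (fun y => ∫ s in (0:ℝ)..y, (y - s) ^ (-p.1) * u p.1 s) (It p.1 p.2) p.2)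
    (hIα : ∀ p ∈ V,
      HasDerivAt (fun τ => ∫ s in (0:ℝ)..p.2, (p.2 - s) ^ (-τ) * u τ s) (Iα p.1 p.2) p.1)
    (Mmix : ℝ)
    (hM1 : HasDerivAt (fun τ => It τ t) Mmix α₀)
    (hM2 : HasDerivAt (fun y => Iα α₀ y) Mmix t)
    (D1 D2 : ℝ)
    (hD1 : HasDerivAt (fun y => ∫ s in (0:ℝ)..y, (y - s) ^ (-α₀) * uα α₀ s) D1 t)
    (hD2 : HasDerivAt
      (fun y => ∫ s in (0:ℝ)..y, Real.log (y - s) * (y - s) ^ (-α₀) * u α₀ s) D2 t) :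
    uα α₀ 0 = 0 ∧
      (1 / Real.Gamma (1 - α₀)) * D1
        = fα t
          - (Real.Gamma (1 - α₀) * deriv (fun τ => 1 / Real.Gamma (1 - τ)) α₀) * f α₀ t
          + (1 / Real.Gamma (1 - α₀)) * D2 := by
  have hΓ : 0 < Real.Gamma (1 - α₀) := Real.Gamma_pos_of_pos (by linarith [hα₀.2])
  have hnhds : ∀ᶠ τ in 𝓝 α₀, τ ∈ Ioo (0 : ℝ) 1 := Ioo_mem_nhds hα₀.1 hα₀.2
  refine ⟨?_, ?_⟩
  · have h := huα α₀ hα₀ 0 ⟨le_rfl, hT.le⟩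
    refine h.unique ((hasDerivAt_const α₀ (0 : ℝ)).congr_of_eventuallyEq ?_)
    filter_upwards [hnhds] with τ hτ using hu0 τ hτ
  have hG : DifferentiableAt ℝ Real.Gamma (1 - α₀) :=
    Real.differentiableAt_Gamma fun m => by
      have : (0 : ℝ) ≤ m := m.cast_nonneg
      have := hα₀.2
      linarith
  have hG' : HasDerivAt (fun τ => Real.Gamma (1 - τ)) (-deriv Real.Gamma (1 - α₀)) α₀ := by
    simpa using hG.hasDerivAt.comp_const_sub 1 α₀
  have hVα : ∀ᶠ τ in 𝓝 α₀, (τ, t) ∈ V :=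
    (Continuous.prodMk_left t).continuousAt.preimage_mem_nhds hV
  have hVt : ∀ᶠ y in 𝓝 t, (α₀, y) ∈ V :=
    (Continuous.prodMk_right α₀).continuousAt.preimage_mem_nhds hV
  have hM_f : Mmix = -deriv Real.Gamma (1 - α₀) * f α₀ t + Real.Gamma (1 - α₀) * fα t := by
    refine hM1.unique ((hG'.mul (hfα t ht)).congr_of_eventuallyEq ?_)
    filter_upwards [hnhds, hVα] with τ hτ hτV
    exact (hIt _ hτV).unique (hFIVP τ hτ t ht)
  have hM_D : Mmix = D1 - D2 := by
    have hIα_eq : ∀ y, (α₀, y) ∈ V → y ∈ Ioc 0 T → Iα α₀ y =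
        (∫ s in (0 : ℝ)..y, (y - s) ^ (-α₀) * uα α₀ s)
          - ∫ s in (0 : ℝ)..y, Real.log (y - s) * (y - s) ^ (-α₀) * u α₀ s :=
      fun y hyV hy => (hIα _ hyV).unique (hasDerivAt_order_integral hα₀ hcont huα hcontα hy)
    refine (uniqueDiffWithinAt_Iic t).eq_deriv _ hM2.hasDerivWithinAt
      ((hD1.sub hD2).hasDerivWithinAt.congr_of_eventuallyEq ?_ (hIα_eq t (mem_of_mem_nhds hV) ht))
    filter_upwards [nhdsWithin_le_nhds hVt, nhdsWithin_le_nhds (Ioi_mem_nhds ht.1),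
      self_mem_nhdsWithin] with y hyV hy0 hyt
    exact hIα_eq y hyV ⟨hy0, le_trans hyt ht.2⟩
  have hderiv : deriv (fun τ => 1 / Real.Gamma (1 - τ)) α₀
      = deriv Real.Gamma (1 - α₀) / Real.Gamma (1 - α₀) ^ 2 := by
    simpa [one_div] using (hG'.fun_inv hΓ.ne').deriv
  have hD : D1 = -deriv Real.Gamma (1 - α₀) * f α₀ t + Real.Gamma (1 - α₀) * fα t + D2 := by
    linarith
  rw [hderiv, hD]
  field_simp
  ring
end
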